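/- Let α,β>-1 and let f be a generalized Φ-function (type I) with parameters a∈(-1,1), λ>-1 and smooth z with z(a)≠0. Then there exist constants C>0 and N, independent of x, such that for all integers n≥N: (i) for every x∈[-1,a)∪(a,1], |a_n^{(α,β)}(x;g)| ≤ C |x-a|^{-1} n^{-λ-1/2}; and (ii) if λ>0, |a_n^{(α,β)}(a;g)| ≤ C n^{-λ+1/2}. -/

import Mathlib

open MeasureTheory Set

/-- Jacobi polynomial via Rodrigues' formula. -/
noncomputable def jacobiP (a b : ℝ) (n : ℕ) (x : ℝ) : ℝ :=
  ((-1 : ℝ) ^ n / (2 ^ n * (n.factorial : ℝ))) * (1 - x) ^ (-a) * (1 + x) ^ (-b) *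
    iteratedDeriv n (fun y => (1 - y) ^ ((n : ℝ) + a) * (1 + y) ^ ((n : ℝ) + b)) x

/-- Jacobi weight. -/
noncomputable def jacobiWeight (a b : ℝ) (x : ℝ) : ℝ := (1 - x) ^ a * (1 + x) ^ b

/-- Normalization constant σ_n^{(α,β)}. -/
noncomputable def jacobiSigma (a b : ℝ) (n : ℕ) : ℝ :=
  2 ^ (a + b + 1) * Real.Gamma ((n : ℝ) + a + 1) * Real.Gamma ((n : ℝ) + b + 1) /
    ((n.factorial : ℝ) * (2 * (n : ℝ) + a + b + 1) * Real.Gamma ((n : ℝ) + a + b + 1))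

/-- Jacobi expansion coefficient of `f`. -/
noncomputable def jacobiCoeff (a b : ℝ) (n : ℕ) (f : ℝ → ℝ) : ℝ :=
  (1 / jacobiSigma a b n) * ∫ x in (-1 : ℝ)..1, f x * jacobiP a b n x * jacobiWeight a b x

/-- Truncated Jacobi expansion S_n^{(α,β)}[f]. -/
noncomputable def jacobiTrunc (a b : ℝ) (n : ℕ) (f : ℝ → ℝ) (x : ℝ) : ℝ :=
  ∑ k ∈ Finset.range (n + 1), jacobiCoeff a b k f * jacobiP a b k x

/-- Pointwise error e_f^{(α,β)}(n,x). -/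
noncomputable def jacobiErr (a b : ℝ) (n : ℕ) (f : ℝ → ℝ) (x : ℝ) : ℝ :=
  |f x - jacobiTrunc a b n f x|

/-- Jacobi coefficient a_n^{(α,β)}(x;g) of the difference quotient g(x,y)=(f(x)-f(y))/(x-y). -/
noncomputable def jacobiCoeffG (a b : ℝ) (n : ℕ) (f : ℝ → ℝ) (x : ℝ) : ℝ :=
  jacobiCoeff a b n (fun y => (f x - f y) / (x - y))

/-- Generalized Φ-function of type I. -/
noncomputable def phiFunI (c lam : ℝ) (z : ℝ → ℝ) (x : ℝ) : ℝ :=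
  if x < c then 0
  else if x = c then (if lam = 0 then z c / 2 else 0)
  else z x * (x - c) ^ lam

/-- Generalized Φ-function of type II. -/
noncomputable def phiFunII (c lam : ℝ) (z : ℝ → ℝ) (x : ℝ) : ℝ := |x - c| ^ lam * z x

/-- `lam` is an even integer. -/
def IsEvenInt (lam : ℝ) : Prop := ∃ k : ℤ, lam = 2 * (k : ℝ)



namespace JacAux

open Polynomial in
/-- Polynomials with `D^j[(1-x)^γ (1+x)^δ] = (1-x)^(γ-j) (1+x)^(δ-j) R_j(x)`. -/
noncomputable def Rp (γ δ : ℝ) : ℕ → Polynomial ℝ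
  | 0 => 1
  | (j+1) => (1 - X^2) * derivative (Rp γ δ j) +
      (C (-(γ - j)) * (1 + X) + C (δ - j) * (1 - X)) * Rp γ δ j

open Polynomial in
lemma Rp_deriv (γ δ : ℝ) (j : ℕ) :
    derivative (Rp γ δ (j+1)) = C (-((j+1) * (γ + δ - j))) * Rp γ δ j := by
  induction j with
  | zero =>
    simp only [Rp, derivative_one]
    simp
    ring
  | succ j ih =>
    have h1 : Rp γ δ (j+1+1) = (1 - X^2) * derivative (Rp γ δ (j+1)) +
      (C (-(γ - (j+1:ℕ))) * (1 + X) + C (δ - (j+1:ℕ)) * (1 - X)) * Rp γ δ (j+1) := rfl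
    have h2 : (1 - X^2) * derivative (Rp γ δ j) = Rp γ δ (j+1) -
      (C (-(γ - j)) * (1 + X) + C (δ - j) * (1 - X)) * Rp γ δ j := by
      rw [Rp]; ring
    rw [h1]
    simp only [derivative_add, derivative_mul, derivative_sub, derivative_one, derivative_X_pow,
      derivative_C, derivative_X, ih, zero_mul]
    have h3 : (1 - X^2 : Polynomial ℝ) * (0 + C (-((j+1) * (γ + δ - j))) * derivative (Rp γ δ j))
       = C (-((j+1) * (γ + δ - j))) * (Rp γ δ (j+1) -
      (C (-(γ - j)) * (1 + X) + C (δ - j) * (1 - X)) * Rp γ δ j) := by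
      rw [← h2]; ring
    have h4 : (1 - X^2 : Polynomial ℝ) * (C (-((j+1) * (γ + δ - j))) * derivative (Rp γ δ j))
       = C (-((j+1) * (γ + δ - j))) * (Rp γ δ (j+1) -
      (C (-(γ - j)) * (1 + X) + C (δ - j) * (1 - X)) * Rp γ δ j) := by
      rw [← h2]; ring
    simp only [zero_add, h4]
    have hC : (C 2 : Polynomial ℝ) = 2 := rfl
    simp [hC]
    ring

/-- Evaluated recursion. -/
lemma Rp_eval_succ (γ δ : ℝ) (j : ℕ) (x : ℝ) :
    (Rp γ δ (j+1)).eval x = (1 - x^2) * (Polynomial.derivative (Rp γ δ j)).eval x +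
      (-(γ - j) * (1 + x) + (δ - j) * (1 - x)) * (Rp γ δ j).eval x := by
  simp [Rp]

/-- `V_j = D^j[(1-x)^γ (1+x)^δ]`. -/
noncomputable def V (γ δ : ℝ) (j : ℕ) (x : ℝ) : ℝ :=
  (1 - x) ^ (γ - j) * (1 + x) ^ (δ - j) * (Rp γ δ j).eval x

lemma V_deriv (γ δ : ℝ) (j : ℕ) {x : ℝ} (hx : x ∈ Ioo (-1 : ℝ) 1) :
    HasDerivAt (V γ δ j) (V γ δ (j+1) x) x := by
  have h1 : 0 < 1 - x := by linarith [hx.2]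
  have h2 : 0 < 1 + x := by linarith [hx.1]
  have d1 : HasDerivAt (fun y : ℝ => (1 - y) ^ (γ - j))
      (-1 * (γ - j) * (1 - x) ^ (γ - j - 1)) x :=
    ((hasDerivAt_id x).const_sub 1).rpow_const (Or.inl h1.ne')
  have d2 : HasDerivAt (fun y : ℝ => (1 + y) ^ (δ - j))
      (1 * (δ - j) * (1 + x) ^ (δ - j - 1)) x :=
    ((hasDerivAt_id x).const_add 1).rpow_const (Or.inl h2.ne')
  have d := (d1.mul d2).mul ((Rp γ δ j).hasDerivAt x)
  refine (d.congr_deriv ?_)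
  have e1 : (1 - x) ^ (γ - j) = (1 - x) ^ (γ - j - 1) * (1 - x) := by
    rw [← Real.rpow_add_one h1.ne']; ring_nf
  have e2 : (1 + x) ^ (δ - j) = (1 + x) ^ (δ - j - 1) * (1 + x) := by
    rw [← Real.rpow_add_one h2.ne']; ring_nf
  have e3 : (γ - ((j+1 : ℕ) : ℝ)) = γ - j - 1 := by push_cast; ring
  have e4 : (δ - ((j+1 : ℕ) : ℝ)) = δ - j - 1 := by push_cast; ring
  simp only [V, Rp_eval_succ, e1, e2, e3, e4, Pi.mul_apply]
  ring

lemma iter_eq (γ δ : ℝ) (j : ℕ) : ∀ x ∈ Ioo (-1 : ℝ) 1,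
    iteratedDeriv j (fun y => (1 - y) ^ γ * (1 + y) ^ δ) x = V γ δ j x := by
  induction j with
  | zero => intro x _; simp [V, Rp]
  | succ j ih =>
    intro x hx
    rw [iteratedDeriv_succ]
    have : iteratedDeriv j (fun y => (1 - y) ^ γ * (1 + y) ^ δ) =ᶠ[nhds x] V γ δ j := by
      filter_upwards [Ioo_mem_nhds hx.1 hx.2] with y hy using ih y hy
    rw [this.deriv_eq, (V_deriv γ δ j hx).deriv]

lemma V_cont (γ δ : ℝ) (j : ℕ) (h1 : 0 < γ - j) (h2 : 0 < δ - j) : Continuous (V γ δ j) := by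
  unfold V
  refine Continuous.mul (Continuous.mul ?_ ?_) (Rp γ δ j).continuous
  · exact (continuous_const.sub continuous_id).rpow_const (fun _ => Or.inr h1.le)
  · exact (continuous_const.add continuous_id).rpow_const (fun _ => Or.inr h2.le)

lemma V_one (γ δ : ℝ) (j : ℕ) (h1 : 0 < γ - j) : V γ δ j 1 = 0 := by
  simp [V, Real.zero_rpow h1.ne']
lemma V_neg_one (γ δ : ℝ) (j : ℕ) (h1 : 0 < δ - j) : V γ δ j (-1) = 0 := by
  simp [V, Real.zero_rpow h1.ne']

lemma weight_int {p q : ℝ} (hp : -1 < p) (hq : -1 < q) :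
    IntervalIntegrable (fun x : ℝ => (1 - x) ^ p * (1 + x) ^ q) volume (-1) 1 := by
  have L : ∀ {p q : ℝ}, -1 < q →
      IntervalIntegrable (fun x : ℝ => (1 - x) ^ p * (1 + x) ^ q) volume (-1) 0 := by
    intro p q hq
    have h0 : IntervalIntegrable (fun x : ℝ => x ^ q) volume 0 1 :=
      intervalIntegral.intervalIntegrable_rpow' hq
    have h1 := (h0.comp_add_right 1)
    have h2 : IntervalIntegrable (fun x : ℝ => (1 + x) ^ q) volume (-1) 0 := by
      have := h1
      simp only [zero_sub, sub_self] at this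
      simpa [add_comm] using this
    refine h2.continuousOn_mul ?_
    intro x hx
    rw [uIcc_of_le (by norm_num)] at hx
    refine ContinuousAt.continuousWithinAt ?_
    have hne : (1:ℝ) - x ≠ 0 := by have := hx.2; linarith
    have hc : ContinuousAt (fun y : ℝ => 1 - y) x := by fun_prop
    exact hc.rpow_const (Or.inl hne)
  refine (L hq).trans ?_
  have h := (L (p := q) (q := p) hp)
  rw [IntervalIntegrable.iff_comp_neg] at h
  simp only [neg_neg, neg_zero] at h
  convert h.symm using 2 with x
  rw [mul_comm]; simp [sub_eq_add_neg]

lemma V_int (γ δ : ℝ) (j : ℕ) (h1 : -1 < γ - j) (h2 : -1 < δ - j) :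
    IntervalIntegrable (V γ δ j) volume (-1) 1 :=
  (weight_int h1 h2).mul_continuousOn (Rp γ δ j).continuous.continuousOn

/-- Squared norm. -/
noncomputable def Nrm (γ δ : ℝ) (j : ℕ) : ℝ := ∫ x in (-1:ℝ)..1, (Rp γ δ j).eval x * V γ δ j x

lemma Nrm_succ (γ δ : ℝ) (j : ℕ) (h1 : 0 < γ - j) (h2 : 0 < δ - j) :
    Nrm γ δ (j+1) = (j+1) * (γ + δ - j) * Nrm γ δ j := by
  unfold Nrm
  have := intervalIntegral.integral_mul_deriv_eq_deriv_mul_of_hasDerivAt (a := -1) (b := 1)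
    (u := fun x => (Rp γ δ (j+1)).eval x) (v := V γ δ j)
    (u' := fun x => (Polynomial.derivative (Rp γ δ (j+1))).eval x) (v' := V γ δ (j+1))
    (Rp γ δ (j+1)).continuous.continuousOn (V_cont γ δ j h1 h2).continuousOn
    (fun x _ => (Rp γ δ (j+1)).hasDerivAt x)
    (fun x hx => V_deriv γ δ j (by simpa using hx))
    ((Polynomial.continuous _).intervalIntegrable _ _)
    (V_int γ δ (j+1) (by push_cast; linarith) (by push_cast; linarith))
  rw [this, V_one γ δ j h1, V_neg_one γ δ j h2, Rp_deriv]
  simp only [Polynomial.eval_mul, Polynomial.eval_C, mul_assoc, intervalIntegral.integral_const_mul]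
  ring

lemma beta_int {p q : ℝ} (hp : -1 < p) (hq : -1 < q) :
    ∫ x in (-1:ℝ)..1, (1 - x) ^ p * (1 + x) ^ q =
      2 ^ (p + q + 1) * (Real.Gamma (p+1) * Real.Gamma (q+1) / Real.Gamma (p + q + 2)) := by
  have hB := ProbabilityTheory.beta_eq_betaIntegralReal (q+1) (p+1) (by linarith) (by linarith)
  have hc : Complex.betaIntegral ((q+1:ℝ):ℂ) ((p+1:ℝ):ℂ) =
      ((∫ x in (0:ℝ)..1, x ^ q * (1 - x) ^ p : ℝ) : ℂ) := by
    rw [Complex.betaIntegral, ← intervalIntegral.integral_ofReal]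
    refine intervalIntegral.integral_congr ?_
    intro x hx
    rw [uIcc_of_le zero_le_one] at hx
    simp only
    push_cast
    rw [Complex.ofReal_cpow hx.1, Complex.ofReal_cpow (by linarith [hx.2])]
    push_cast
    congr 2 <;> ring
  rw [hc, Complex.ofReal_re, ProbabilityTheory.beta] at hB
  have hs := intervalIntegral.integral_comp_mul_add (a := 0) (b := 1) (c := 2)
      (fun x : ℝ => (1 - x) ^ p * (1 + x) ^ q) two_ne_zero (-1)
  have e : ∀ x ∈ uIcc (0:ℝ) 1, (fun x : ℝ => (1 - (2 * x + -1)) ^ p * (1 + (2 * x + -1)) ^ q) x =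
     (fun x : ℝ => 2 ^ (p + q) * (x ^ q * (1 - x) ^ p)) x := by
    intro x hx
    rw [uIcc_of_le zero_le_one] at hx
    simp only
    rw [show 1 - (2 * x + -1) = 2 * (1 - x) by ring, show 1 + (2 * x + -1) = 2 * x by ring,
      Real.mul_rpow zero_le_two (by linarith [hx.2]), Real.mul_rpow zero_le_two hx.1,
      Real.rpow_add two_pos]
    ring
  rw [intervalIntegral.integral_congr e, intervalIntegral.integral_const_mul, ← hB] at hs
  norm_num at hs
  have : (2:ℝ) ^ (p + q + 1) = 2 ^ (p+q) * 2 := by rw [Real.rpow_add_one two_ne_zero]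
  rw [this, show p + q + 2 = q + 1 + (p + 1) by ring]
  linear_combination (-2) * hs

end JacAux


namespace JacAux

lemma Nrm_zero (γ δ : ℝ) (hγ : -1 < γ) (hδ : -1 < δ) : Nrm γ δ 0 =
    2 ^ (γ + δ + 1) * (Real.Gamma (γ+1) * Real.Gamma (δ+1) / Real.Gamma (γ + δ + 2)) := by
  rw [← beta_int hγ hδ]
  simp [Nrm, V, Rp]

lemma Nrm_eq (γ δ : ℝ) (j : ℕ) : (∀ i < j, 0 < γ - i ∧ 0 < δ - i) →
    Nrm γ δ j = (j.factorial : ℝ) * (∏ i ∈ Finset.range j, (γ + δ - i)) * Nrm γ δ 0 := by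
  induction j with
  | zero => intro _; simp
  | succ j ih =>
    intro h
    rw [Nrm_succ γ δ j (h j (by omega)).1 (h j (by omega)).2, ih (fun i hi => h i (by omega)),
      Finset.prod_range_succ, Nat.factorial_succ]
    push_cast; ring

lemma Nrm_pos (γ δ : ℝ) (hγ : -1 < γ) (hδ : -1 < δ) (j : ℕ)
    (h : ∀ i < j, 0 < γ - i ∧ 0 < δ - i) : 0 < Nrm γ δ j := by
  cases j with
  | zero =>
    rw [Nrm_zero γ δ hγ hδ]
    have h1 := Real.Gamma_pos_of_pos (show 0 < γ + 1 by linarith)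
    have h2 := Real.Gamma_pos_of_pos (show 0 < δ + 1 by linarith)
    have h3 := Real.Gamma_pos_of_pos (show 0 < γ + δ + 2 by linarith)
    positivity
  | succ j =>
    rw [Nrm_eq γ δ _ h]
    have h0 : 0 < Nrm γ δ 0 := by
      rw [Nrm_zero γ δ hγ hδ]
      have h1 := Real.Gamma_pos_of_pos (show 0 < γ + 1 by linarith)
      have h2 := Real.Gamma_pos_of_pos (show 0 < δ + 1 by linarith)
      have h3 := Real.Gamma_pos_of_pos (show 0 < γ + δ + 2 by linarith)
      positivity
    have hp : 0 < ∏ i ∈ Finset.range (j+1), (γ + δ - i) := by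
      refine Finset.prod_pos ?_
      intro i hi
      have := h i (Finset.mem_range.mp hi)
      have hj := (h 0 (by omega))
      simp at hj
      linarith
    positivity

lemma Gamma_prod (s : ℝ) (j : ℕ) : (∀ i < j, s - i ≠ 0) →
    (∏ i ∈ Finset.range j, (s - i)) * Real.Gamma (s + 1 - j) = Real.Gamma (s + 1) := by
  induction j with
  | zero => intro _; simp
  | succ j ih =>
    intro h
    rw [← ih (fun i hi => h i (by omega)), Finset.prod_range_succ]
    have : Real.Gamma (s + 1 - j) = (s - j) * Real.Gamma (s - j) := by
      rw [← Real.Gamma_add_one (h j (by omega))]; ring_nf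
    rw [this, show s + 1 - ((j+1 : ℕ):ℝ) = s - j by push_cast; ring]
    ring

lemma Nrm_sigma (α β : ℝ) (hα : -1 < α) (hβ : -1 < β) (n : ℕ) (hn : 1 ≤ n) :
    Nrm (n + α) (n + β) n = (2 ^ n * (n.factorial : ℝ))^2 * jacobiSigma α β n := by
  have hn' : (1:ℝ) ≤ n := by exact_mod_cast hn
  have hi : ∀ i < n, (i:ℝ) + 1 ≤ n := fun i hi => by exact_mod_cast hi
  rw [Nrm_eq _ _ _ (fun i h => ⟨by linarith [hi i h], by linarith [hi i h]⟩),
    Nrm_zero _ _ (by linarith) (by linarith), jacobiSigma]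
  have hg := Gamma_prod ((n:ℝ) + α + (n + β)) n (fun i h => by
    have := hi i h
    have : 0 < (n:ℝ) + α + (n + β) - i := by linarith
    exact this.ne')
  have hg2 : Real.Gamma ((n:ℝ) + α + (n + β) + 2) =
      ((n:ℝ) + α + (n + β) + 1) * Real.Gamma ((n:ℝ) + α + (n + β) + 1) := by
    rw [← Real.Gamma_add_one (by
      have : 0 < (n:ℝ) + α + (n + β) + 1 := by linarith
      exact this.ne')]
    ring_nf
  rw [hg2, ← hg]
  have e : (n:ℝ) + α + (n + β) + 1 - n = n + α + β + 1 := by ring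
  rw [e]
  have p1 : 0 < Real.Gamma ((n:ℝ) + α + β + 1) := Real.Gamma_pos_of_pos (by linarith)
  have p2 : 0 < ∏ i ∈ Finset.range n, ((n:ℝ) + α + (n + β) - i) := by
    refine Finset.prod_pos (fun i h => ?_)
    have := hi i (Finset.mem_range.mp h)
    linarith
  have p3 : 0 < 2 * (n:ℝ) + α + β + 1 := by linarith
  have e3 : (n:ℝ) + α + (n + β) + 1 = 2 * (n:ℝ) + α + β + 1 := by ring
  rw [e3]
  have e4 : (2:ℝ) ^ (2 * (n:ℝ) + α + β + 1) = (2^n)^2 * 2 ^ (α + β + 1) := by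
    rw [show 2 * (n:ℝ) + α + β + 1 = ((n*2 : ℕ) : ℝ) + (α + β + 1) by push_cast; ring,
      Real.rpow_add two_pos, Real.rpow_natCast, pow_mul]
  rw [e4]
  field_simp

lemma Gamma_add_prod (s : ℝ) (hs : 0 < s) (n : ℕ) :
    Real.Gamma (s + n) = (∏ j ∈ Finset.range n, (s + j)) * Real.Gamma s := by
  induction n with
  | zero => simp
  | succ n ih =>
    rw [Finset.prod_range_succ, show s + ((n+1 : ℕ):ℝ) = (s + n) + 1 by push_cast; ring,
      Real.Gamma_add_one (by positivity), ih]
    ring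

lemma Gamma_asymp (s : ℝ) (hs : 0 < s) : ∃ N : ℕ, ∀ m ≥ N,
    Real.Gamma (s + m + 1) ≤ 2 * ((m:ℝ)^s * m.factorial) ∧
    (m:ℝ)^s * m.factorial ≤ 2 * Real.Gamma (s + m + 1) := by
  have h := (Real.GammaSeq_tendsto_Gamma s)
  have hG := Real.Gamma_pos_of_pos hs
  have h1 := h.eventually (lt_mem_nhds (show Real.Gamma s / 2 < Real.Gamma s by linarith))
  have h2 := h.eventually (gt_mem_nhds (show Real.Gamma s < 2 * Real.Gamma s by linarith))
  obtain ⟨N, hN⟩ := Filter.eventually_atTop.mp (h1.and h2)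
  refine ⟨N, fun m hm => ?_⟩
  obtain ⟨a1, a2⟩ := hN m hm
  rw [Real.GammaSeq] at a1 a2
  have hp : 0 < ∏ j ∈ Finset.range (m + 1), (s + j) :=
    Finset.prod_pos (fun i _ => by positivity)
  rw [lt_div_iff₀ hp] at a1
  rw [div_lt_iff₀ hp] at a2
  have e : Real.Gamma (s + m + 1) = (∏ j ∈ Finset.range (m+1), (s + j)) * Real.Gamma s := by
    rw [← Gamma_add_prod s hs]; push_cast; ring_nf
  rw [e]
  constructor <;> nlinarith

lemma sigma_lower (α β : ℝ) (hα : -1 < α) (hβ : -1 < β) : ∃ c : ℝ, 0 < c ∧ ∃ N : ℕ, ∀ n ≥ N,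
    c / n ≤ jacobiSigma α β n := by
  obtain ⟨N1, h1⟩ := Gamma_asymp (α + 1) (by linarith)
  obtain ⟨N2, h2⟩ := Gamma_asymp (β + 1) (by linarith)
  obtain ⟨N3, h3⟩ := Gamma_asymp (α + β + 2) (by linarith)
  refine ⟨2 ^ (α + β + 1) / 32, by positivity, N1 + N2 + N3 + 3, fun n hn => ?_⟩
  obtain ⟨m, rfl⟩ : ∃ m, n = m + 1 := ⟨n - 1, by omega⟩
  have g1 := (h1 m (by omega)).2
  have g2 := (h2 m (by omega)).2
  have g3 := (h3 m (by omega)).1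
  have hm : (2:ℝ) ≤ m := by exact_mod_cast (show 2 ≤ m by omega)
  have hm0 : (0:ℝ) < m := by linarith
  have e1 : α + 1 + m + 1 = ((m+1:ℕ):ℝ) + α + 1 := by push_cast; ring
  have e2 : β + 1 + m + 1 = ((m+1:ℕ):ℝ) + β + 1 := by push_cast; ring
  have e3 : Real.Gamma (α + β + 2 + m + 1) =
     (((m+1:ℕ):ℝ) + α + β + 1) * Real.Gamma (((m+1:ℕ):ℝ) + α + β + 1) := by
    rw [← Real.Gamma_add_one (by
      have : 0 < ((m+1:ℕ):ℝ) + α + β + 1 := by push_cast; linarith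
      exact this.ne')]
    push_cast; ring_nf
  rw [e1] at g1
  rw [e2] at g2
  rw [e3] at g3
  rw [jacobiSigma]
  have p3 : 0 < Real.Gamma (((m+1:ℕ):ℝ) + α + β + 1) :=
    Real.Gamma_pos_of_pos (by push_cast; linarith)
  set G1 := Real.Gamma (((m+1:ℕ):ℝ) + α + 1)
  set G2 := Real.Gamma (((m+1:ℕ):ℝ) + β + 1)
  set G3 := Real.Gamma (((m+1:ℕ):ℝ) + α + β + 1)
  have pw : (m:ℝ) ^ (α + β + 2) = (m:ℝ)^(α+1) * (m:ℝ)^(β+1) := by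
    rw [← Real.rpow_add hm0]; ring_nf
  set A := (m:ℝ)^(α+1)
  set B := (m:ℝ)^(β+1)
  have hA : 0 < A := Real.rpow_pos_of_pos hm0 _
  have hB : 0 < B := Real.rpow_pos_of_pos hm0 _
  rw [pw] at g3
  have hf : (0:ℝ) < m.factorial := by positivity
  have ef : (((m+1).factorial : ℕ) : ℝ) = (m+1) * m.factorial := by
    rw [Nat.factorial_succ]; push_cast; ring
  rw [ef]
  have q : 0 < 2 * ((m+1:ℕ):ℝ) + α + β + 1 := by push_cast; linarith
  have hprod : A * m.factorial * (B * m.factorial) ≤ 2 * G1 * (2 * G2) :=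
    mul_le_mul g1 g2 (by positivity) (le_trans (by positivity) g1)
  have hq : 2 * ((m+1:ℕ):ℝ) + α + β + 1 ≤ 4 * (((m+1:ℕ):ℝ) + α + β + 1) := by
    push_cast; linarith
  have key : (m.factorial:ℝ) * (2 * ((m+1:ℕ):ℝ) + α + β + 1) * G3 ≤ 32 * (G1 * G2) := by
    calc (m.factorial:ℝ) * (2 * ((m+1:ℕ):ℝ) + α + β + 1) * G3
        ≤ (m.factorial:ℝ) * (4 * (((m+1:ℕ):ℝ) + α + β + 1)) * G3 := by gcongr
      _ = 4 * m.factorial * ((((m+1:ℕ):ℝ) + α + β + 1) * G3) := by ring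
      _ ≤ 4 * m.factorial * (2 * (A * B * m.factorial)) := by gcongr
      _ ≤ 32 * (G1 * G2) := by nlinarith
  have p2 : (0:ℝ) < 2 ^ (α + β + 1) := by positivity
  rw [div_div, div_le_div_iff₀ (by positivity) (by positivity)]
  push_cast at key ⊢
  calc (2:ℝ) ^ (α + β + 1) * ((m + 1) * ↑m.factorial * (2 * (↑m + 1) + α + β + 1) * G3)
      = 2 ^ (α + β + 1) * (m+1) * (↑m.factorial * (2 * (↑m + 1) + α + β + 1) * G3) := by ring
    _ ≤ 2 ^ (α + β + 1) * (m+1) * (32 * (G1 * G2)) := by gcongr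
    _ = _ := by ring

end JacAux


namespace JacAux

lemma pw_lower {d t p B : ℝ} (hd : 0 < d) (hd1 : d ≤ 1) (ht : d ≤ t) (ht2 : t ≤ 2) (hp : |p| ≤ B) :
    (d/2) ^ B ≤ t ^ p := by
  have ht0 : 0 < t := by linarith
  rw [abs_le] at hp
  rcases le_total 0 p with h | h
  · calc (d/2)^B ≤ (d/2)^p :=
          Real.rpow_le_rpow_of_exponent_ge (by positivity) (by linarith) hp.2
      _ ≤ t ^ p := Real.rpow_le_rpow (by positivity) (by linarith) h
  · calc (d/2)^B ≤ (1/2)^B := Real.rpow_le_rpow (by positivity) (by linarith) (by linarith)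
      _ ≤ (1/2)^(-p) := Real.rpow_le_rpow_of_exponent_ge (by positivity) (by linarith) (by linarith)
      _ = 2 ^ p := by rw [Real.rpow_neg (by norm_num), one_div, Real.inv_rpow (by norm_num), inv_inv]
      _ ≤ t ^ p := Real.rpow_le_rpow_of_nonpos ht0 ht2 h

lemma pw_upper {d t p B : ℝ} (hd : 0 < d) (hd1 : d ≤ 1) (ht : d ≤ t) (ht2 : t ≤ 2) (hp : |p| ≤ B) :
    t ^ p ≤ (2/d) ^ B := by
  have ht0 : 0 < t := by linarith
  have h := pw_lower (p := -p) (B := B) hd hd1 ht ht2 (by rwa [abs_neg])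
  have h2 := inv_anti₀ (by positivity) h
  rwa [Real.rpow_neg ht0.le, inv_inv, ← Real.inv_rpow (by positivity), inv_div] at h2

/-- Sonine-type energy. -/
noncomputable def En (γ δ : ℝ) (J : ℕ) (x : ℝ) : ℝ :=
  ((Rp γ δ (J+1)).eval x)^2 + (J+1) * (γ + δ - J) * ((1 - x^2) * ((Rp γ δ J).eval x)^2)

lemma En_deriv (γ δ : ℝ) (J : ℕ) (x : ℝ) : HasDerivAt (En γ δ J)
    (-2 * ((J+1) * (γ + δ - J)) * (-(γ - J) * (1 + x) + (δ - J) * (1 - x) + x) *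
      ((Rp γ δ J).eval x)^2) x := by
  have d1 := ((Rp γ δ (J+1)).hasDerivAt x).pow 2
  have d2 := ((Rp γ δ J).hasDerivAt x).pow 2
  have d3 : HasDerivAt (fun x : ℝ => 1 - x^2) (-(2 * x)) x := by
    simpa using ((hasDerivAt_id x).pow 2).const_sub 1
  have d := d1.add ((d3.mul d2).const_mul (((J:ℝ)+1) * (γ + δ - J)))
  refine d.congr_deriv ?_
  rw [Rp_deriv]
  simp only [Pi.pow_apply, Polynomial.eval_mul, Polynomial.eval_C, Rp_eval_succ]
  push_cast
  ring

lemma En_nonneg (γ δ : ℝ) (J : ℕ) (h : 0 ≤ γ + δ - J) {x : ℝ} (hx : |x| ≤ 1) :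
    0 ≤ En γ δ J x := by
  have : 0 ≤ 1 - x^2 := by have := (sq_le_one_iff_abs_le_one x).mpr hx; linarith
  unfold En; positivity

lemma En_deriv_bound (γ δ : ℝ) (J : ℕ) (h : 0 ≤ γ + δ - J) {B d : ℝ} (hd : 0 < d) (hd1 : d < 1)
    (hB1 : |γ - J| ≤ B) (hB2 : |δ - J| ≤ B) {x : ℝ} (hx : |x| ≤ 1 - d) :
    |-2 * ((J+1) * (γ + δ - J)) * (-(γ - J) * (1 + x) + (δ - J) * (1 - x) + x) *
      ((Rp γ δ J).eval x)^2| ≤ (2 * (4 * B + 1) / d) * En γ δ J x := by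
  have hx' := abs_le.mp hx
  have hB0 : 0 ≤ B := le_trans (abs_nonneg _) hB1
  have hL : |-(γ - J) * (1 + x) + (δ - J) * (1 - x) + x| ≤ 4 * B + 1 := by
    calc |-(γ - J) * (1 + x) + (δ - J) * (1 - x) + x|
        ≤ |γ - J| * |1 + x| + |δ - J| * |1 - x| + |x| := by
          refine (abs_add_le _ _).trans ?_
          gcongr
          refine (abs_add_le _ _).trans ?_
          rw [abs_mul, abs_neg, abs_mul]
      _ ≤ B * 2 + B * 2 + 1 := by
          gcongr
          · rw [abs_le]; constructor <;> linarith
          · rw [abs_le]; constructor <;> linarith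
          · linarith
      _ = _ := by ring
  have h1 : d ≤ 1 - x^2 := by nlinarith
  have hμ : 0 ≤ ((J:ℝ)+1) * (γ + δ - J) := by positivity
  rw [abs_mul, abs_mul, abs_mul, abs_of_nonneg hμ, abs_of_nonneg (sq_nonneg ((Rp γ δ J).eval x))]
  have e : |(-2:ℝ)| = 2 := by norm_num
  rw [e]
  set R2 := ((Rp γ δ J).eval x)^2
  have hR2 : 0 ≤ R2 := sq_nonneg _
  calc 2 * ((J+1) * (γ + δ - J)) * |-(γ - J) * (1 + x) + (δ - J) * (1 - x) + x| * R2
      ≤ 2 * ((J+1) * (γ + δ - J)) * (4 * B + 1) * R2 := by gcongr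
    _ = (2 * (4 * B + 1) / d) * ((J+1) * (γ + δ - J) * (d * R2)) := by field_simp
    _ ≤ (2 * (4 * B + 1) / d) * ((J+1) * (γ + δ - J) * ((1 - x^2) * R2)) := by gcongr
    _ ≤ _ := by
      unfold En
      gcongr
      have := sq_nonneg ((Rp γ δ (J+1)).eval x)
      linarith

/-- Gronwall type comparison. -/
lemma gronwall_cmp {E E' : ℝ → ℝ} {p q D : ℝ} (hE : ∀ x, HasDerivAt E (E' x) x)
    (h0 : ∀ x ∈ Icc p q, 0 ≤ E x) (hD0 : 0 ≤ D)
    (hb : ∀ x ∈ Icc p q, |E' x| ≤ D * E x) {x y : ℝ} (hx : x ∈ Icc p q) (hy : y ∈ Icc p q) :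
    E x ≤ Real.exp (D * (q - p)) * E y := by
  have d1 : ∀ t, HasDerivAt (fun t => Real.exp (D * t) * E t)
      (Real.exp (D * t) * (D * 1) * E t + Real.exp (D * t) * E' t) t := fun t =>
    (((hasDerivAt_id t).const_mul D).exp).mul (hE t)
  have d2 : ∀ t, HasDerivAt (fun t => Real.exp (-D * t) * E t)
      (Real.exp (-D * t) * (-D * 1) * E t + Real.exp (-D * t) * E' t) t := fun t =>
    (((hasDerivAt_id t).const_mul (-D)).exp).mul (hE t)
  have m1 : MonotoneOn (fun t => Real.exp (D * t) * E t) (Icc p q) := by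
    refine monotoneOn_of_deriv_nonneg (convex_Icc p q)
      (fun t _ => (d1 t).continuousAt.continuousWithinAt)
      (fun t _ => (d1 t).differentiableAt.differentiableWithinAt) ?_
    intro t ht
    rw [interior_Icc] at ht
    rw [(d1 t).deriv]
    have := abs_le.mp (hb t (Ioo_subset_Icc_self ht))
    have e := Real.exp_pos (D * t)
    nlinarith
  have m2 : AntitoneOn (fun t => Real.exp (-D * t) * E t) (Icc p q) := by
    refine antitoneOn_of_deriv_nonpos (convex_Icc p q)
      (fun t _ => (d2 t).continuousAt.continuousWithinAt)
      (fun t _ => (d2 t).differentiableAt.differentiableWithinAt) ?_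
    intro t ht
    rw [interior_Icc] at ht
    rw [(d2 t).deriv]
    have := abs_le.mp (hb t (Ioo_subset_Icc_self ht))
    have e := Real.exp_pos (-D * t)
    nlinarith
  have hEy := h0 y hy
  rcases le_total x y with h | h
  · have := m1 hx hy h
    simp only at this
    have h2 : E x ≤ Real.exp (D * y - D * x) * E y := by
      rw [Real.exp_sub, div_mul_eq_mul_div, le_div_iff₀ (Real.exp_pos _)]
      linarith
    refine h2.trans ?_
    gcongr
    have := hy.2; have := hx.1
    nlinarith
  · have := m2 hy hx h
    simp only at this
    have h2 : E x ≤ Real.exp (D * x - D * y) * E y := by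
      have e : Real.exp (D * x - D * y) = Real.exp (-D * y) / Real.exp (-D * x) := by
        rw [← Real.exp_sub]; ring_nf
      rw [e, div_mul_eq_mul_div, le_div_iff₀ (Real.exp_pos _)]
      linarith
    refine h2.trans ?_
    gcongr
    have := hx.2; have := hy.1
    nlinarith

/-- The local sup bound. -/
lemma R_local {B d : ℝ} (hd : 0 < d) (hd1 : d < 1) (hB : 0 ≤ B) : ∃ C : ℝ, 0 < C ∧
    ∀ (γ δ : ℝ) (J : ℕ), 0 < γ - J → 0 < δ - J → |γ - J| ≤ B → |δ - J| ≤ B →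
      |γ - (J+1:ℕ)| ≤ B → |δ - (J+1:ℕ)| ≤ B → ∀ x : ℝ, |x| ≤ 1 - d →
      ((Rp γ δ (J+1)).eval x)^2 ≤ C * Nrm γ δ (J+1) := by
  set D := 2 * (4 * B + 1) / d with hD
  have hD0 : 0 ≤ D := by positivity
  set c := (d/2) ^ B * (d/2) ^ B with hc
  have hc0 : 0 < c := by positivity
  have hdd : 0 < 1 - d := by linarith
  refine ⟨Real.exp (D * ((1-d) - (-(1-d)))) * 2 / (c * (2 * (1 - d))), by positivity, ?_⟩
  intro γ δ J g1 g2 b1 b2 b3 b4 x hx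
  have hs : 0 ≤ γ + δ - J := by
    have : (0:ℝ) ≤ J := by positivity
    linarith
  have hg : ∀ y ∈ Icc (-(1-d)) (1-d),
      En γ δ J x ≤ Real.exp (D * ((1-d) - (-(1-d)))) * En γ δ J y := fun y hy =>
    gronwall_cmp (En_deriv γ δ J)
      (fun t ht => En_nonneg γ δ J hs (by rw [abs_le]; constructor <;> linarith [ht.1, ht.2])) hD0
      (fun t ht => En_deriv_bound γ δ J hs hd hd1 b1 b2
        (by rw [abs_le]; constructor <;> linarith [ht.1, ht.2]))
      (abs_le.mp hx) hy
  set F : ℝ → ℝ := fun y => (Rp γ δ (J+1)).eval y * V γ δ (J+1) y +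
    (J+1) * (γ + δ - J) * ((Rp γ δ J).eval y * V γ δ J y) with hF
  have hJ1 : γ - ((J+1:ℕ):ℝ) = γ - J - 1 := by push_cast; ring
  have hJ2 : δ - ((J+1:ℕ):ℝ) = δ - J - 1 := by push_cast; ring
  have i1 : IntervalIntegrable (fun y => (Rp γ δ (J+1)).eval y * V γ δ (J+1) y) volume (-1) 1 :=
    (V_int γ δ (J+1) (by rw [hJ1]; linarith) (by rw [hJ2]; linarith)).continuousOn_mul
      (Polynomial.continuous _).continuousOn
  have i2 : IntervalIntegrable (fun y => (Rp γ δ J).eval y * V γ δ J y) volume (-1) 1 :=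
    (V_int γ δ J (by linarith) (by linarith)).continuousOn_mul
      (Polynomial.continuous _).continuousOn
  have iF : IntervalIntegrable F volume (-1) 1 := i1.add (i2.const_mul _)
  have hFint : ∫ y in (-1:ℝ)..1, F y = 2 * Nrm γ δ (J+1) := by
    rw [hF, intervalIntegral.integral_add i1 (i2.const_mul _), intervalIntegral.integral_const_mul]
    change Nrm γ δ (J+1) + (J+1) * (γ + δ - J) * Nrm γ δ J = _
    rw [Nrm_succ γ δ J g1 g2]; ring
  have hμ : 0 ≤ ((J:ℝ)+1) * (γ + δ - J) := by positivity
  have hF0 : ∀ y ∈ Icc (-1:ℝ) 1, 0 ≤ F y := by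
    intro y hy
    have y1 : 0 ≤ 1 - y := by linarith [hy.2]
    have y2 : 0 ≤ 1 + y := by linarith [hy.1]
    have r1 := Real.rpow_nonneg y1 (γ - ((J+1:ℕ):ℝ))
    have r2 := Real.rpow_nonneg y2 (δ - ((J+1:ℕ):ℝ))
    have r3 := Real.rpow_nonneg y1 (γ - J)
    have r4 := Real.rpow_nonneg y2 (δ - J)
    have e : F y = (1 - y) ^ (γ - ((J+1:ℕ):ℝ)) * (1 + y) ^ (δ - ((J+1:ℕ):ℝ)) *
        ((Rp γ δ (J+1)).eval y)^2 + (J+1) * (γ + δ - J) *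
        ((1 - y) ^ (γ - J) * (1 + y) ^ (δ - J) * ((Rp γ δ J).eval y)^2) := by
      simp only [hF, V]; ring
    rw [e]; positivity
  have hFE : ∀ y ∈ Icc (-(1-d)) (1-d), c * En γ δ J y ≤ F y := by
    intro y hy
    have e : F y = (1 - y) ^ (γ - ((J+1:ℕ):ℝ)) * (1 + y) ^ (δ - ((J+1:ℕ):ℝ)) *
        ((Rp γ δ (J+1)).eval y)^2 + (J+1) * (γ + δ - J) *
        ((1 - y) ^ (γ - J) * (1 + y) ^ (δ - J) * ((Rp γ δ J).eval y)^2) := by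
      simp only [hF, V]; ring
    have a1 : d ≤ 1 - y := by linarith [hy.2]
    have a2 : 1 - y ≤ 2 := by linarith [hy.1]
    have a3 : d ≤ 1 + y := by linarith [hy.1]
    have a4 : 1 + y ≤ 2 := by linarith [hy.2]
    have w1 : c ≤ (1 - y) ^ (γ - ((J+1:ℕ):ℝ)) * (1 + y) ^ (δ - ((J+1:ℕ):ℝ)) :=
      mul_le_mul (pw_lower hd hd1.le a1 a2 b3) (pw_lower hd hd1.le a3 a4 b4) (by positivity)
        (Real.rpow_nonneg (by linarith) _)
    have w2 : c ≤ (1 - y) ^ (γ - J) * (1 + y) ^ (δ - J) :=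
      mul_le_mul (pw_lower hd hd1.le a1 a2 b1) (pw_lower hd hd1.le a3 a4 b2) (by positivity)
        (Real.rpow_nonneg (by linarith) _)
    rw [e, En, mul_add]
    have hy2 : 1 - y^2 ≤ 1 := by nlinarith
    have k2 : c * ((J+1) * (γ + δ - J) * ((1 - y^2) * ((Rp γ δ J).eval y)^2)) ≤
        (J+1) * (γ + δ - J) *
        ((1 - y) ^ (γ - J) * (1 + y) ^ (δ - J) * ((Rp γ δ J).eval y)^2) := by
      calc c * ((J+1) * (γ + δ - J) * ((1 - y^2) * ((Rp γ δ J).eval y)^2))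
          ≤ c * ((J+1) * (γ + δ - J) * (1 * ((Rp γ δ J).eval y)^2)) := by gcongr
        _ = (J+1) * (γ + δ - J) * (c * ((Rp γ δ J).eval y)^2) := by ring
        _ ≤ _ := by gcongr
    have k1 := mul_le_mul_of_nonneg_right w1 (sq_nonneg ((Rp γ δ (J+1)).eval y))
    linarith
  set e0 := Real.exp (D * ((1-d) - (-(1-d)))) with he0
  have he0p : 0 < e0 := Real.exp_pos _
  have hsub : IntervalIntegrable F volume (-(1-d)) (1-d) := by
    refine iF.mono_set ?_
    rw [uIcc_of_le (by linarith), uIcc_of_le (by linarith)]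
    exact Icc_subset_Icc (by linarith) (by linarith)
  have hintg : c * En γ δ J x * (2 * (1 - d)) ≤ e0 * ∫ y in (-(1-d))..(1-d), F y := by
    rw [← intervalIntegral.integral_const_mul]
    have := intervalIntegral.integral_mono_on (a := -(1-d)) (b := 1-d) (by linarith)
      (f := fun _ => c * En γ δ J x) (g := fun y => e0 * F y) (by simp)
      (hsub.const_mul _) (fun y hy => by
        have h1 := hg y hy
        have h2 := hFE y hy
        calc c * En γ δ J x ≤ c * (e0 * En γ δ J y) := by gcongr
          _ = e0 * (c * En γ δ J y) := by ring
          _ ≤ e0 * F y := by gcongr)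
    rw [intervalIntegral.integral_const] at this
    simp only [smul_eq_mul] at this
    linarith
  have hle : ∫ y in (-(1-d))..(1-d), F y ≤ ∫ y in (-1:ℝ)..1, F y := by
    refine intervalIntegral.integral_mono_interval (by linarith) (by linarith) (by linarith) ?_ iF
    refine (ae_restrict_iff' measurableSet_Ioc).mpr (Filter.Eventually.of_forall ?_)
    intro y hy
    exact hF0 y (Ioc_subset_Icc_self hy)
  rw [hFint] at hle
  have hEn : ((Rp γ δ (J+1)).eval x)^2 ≤ En γ δ J x := by
    unfold En
    have hx1 : 0 ≤ 1 - x^2 := by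
      have := (sq_le_one_iff_abs_le_one x).mpr (by linarith); linarith
    have : 0 ≤ ((J:ℝ)+1) * (γ + δ - J) * ((1 - x^2) * ((Rp γ δ J).eval x)^2) := by positivity
    linarith
  rw [div_mul_eq_mul_div, le_div_iff₀ (by positivity)]
  calc ((Rp γ δ (J+1)).eval x)^2 * (c * (2 * (1 - d)))
      ≤ En γ δ J x * (c * (2 * (1-d))) := by gcongr
    _ = c * En γ δ J x * (2 * (1 - d)) := by ring
    _ ≤ e0 * ∫ y in (-(1-d))..(1-d), F y := hintg
    _ ≤ e0 * (2 * Nrm γ δ (J+1)) := by gcongr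
    _ = _ := by ring

end JacAux


namespace JacAux

/-- Abstract oscillatory kernel family. -/
structure Ker (K : ℕ) (C d ν : ℝ) (φ : ℕ → ℝ → ℝ) : Prop where
  der : ∀ k < K, ∀ y ∈ Ioo (-1:ℝ) 1, HasDerivAt (φ (k+1)) (φ k y) y
  cont : ∀ k < K, Continuous (φ (k+1))
  one : ∀ k < K, φ (k+1) 1 = 0
  neg_one : ∀ k < K, φ (k+1) (-1) = 0
  int0 : IntervalIntegrable (φ 0) volume (-1) 1
  loc : ∀ k ≤ K, ∀ y : ℝ, |y| ≤ 1 - d → |φ k y| ≤ C * (ν^k)⁻¹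
  l1 : ∫ y in (-1:ℝ)..1, |φ K y| ≤ C * (ν^K)⁻¹

lemma Nrm_ratio (α β : ℝ) (hα : -1 < α) (hβ : -1 < β) (K n : ℕ) (hn : 2 * K + 2 ≤ n) :
    ∀ k ≤ K, ((n:ℝ)^k)^2 * Nrm (n + α) (n + β) (n - k) ≤ 4^k * Nrm (n+α) (n+β) n := by
  intro k
  induction k with
  | zero => intro _; simp
  | succ k ih =>
    intro hk
    have h1 := ih (by omega)
    obtain ⟨j, hj⟩ : ∃ j, n - k = j + 1 := ⟨n - k - 1, by omega⟩
    have hj2 : n - (k+1) = j := by omega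
    rw [hj] at h1
    rw [hj2]
    have hjn : (j:ℝ) + 1 ≤ n := by exact_mod_cast (show j + 1 ≤ n by omega)
    have hjn2 : (n:ℝ) ≤ 2 * (j + 1) := by exact_mod_cast (show n ≤ 2 * (j+1) by omega)
    have hn2 : (2:ℝ) ≤ n := by exact_mod_cast (show 2 ≤ n by omega)
    rw [Nrm_succ _ _ j (by linarith) (by linarith)] at h1
    have hpos : 0 < Nrm (n+α) (n+β) j := Nrm_pos _ _ (by linarith) (by linarith) j (by
      intro i hi
      have : (i:ℝ) + 1 ≤ j := by exact_mod_cast hi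
      constructor <;> linarith)
    have hf : (n:ℝ)^2 ≤ 4 * ((j + 1) * (n + α + (n + β) - j)) := by
      have : (n:ℝ) ≤ 2 * (n + α + (n + β) - j) := by linarith
      nlinarith
    calc ((n:ℝ)^(k+1))^2 * Nrm (n + α) (n + β) j
        = ((n:ℝ)^k)^2 * ((n:ℝ)^2 * Nrm (n + α) (n + β) j) := by ring
      _ ≤ ((n:ℝ)^k)^2 * (4 * ((j + 1) * (n + α + (n + β) - j)) * Nrm (n + α) (n + β) j) := by gcongr
      _ = 4 * (((n:ℝ)^k)^2 * ((j + 1) * (n + α + (n + β) - j) * Nrm (n + α) (n + β) j)) := by ring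
      _ ≤ 4 * (4^k * Nrm (n+α) (n+β) n) := by gcongr
      _ = _ := by ring

lemma coeff_eq (α β : ℝ) (n : ℕ) (f : ℝ → ℝ) : jacobiCoeff α β n f =
    (1 / jacobiSigma α β n) * (((-1 : ℝ) ^ n / (2 ^ n * (n.factorial : ℝ))) *
      ∫ x in (-1:ℝ)..1, f x * V (n+α) (n+β) n x) := by
  unfold jacobiCoeff
  congr 1
  rw [← intervalIntegral.integral_const_mul]
  refine intervalIntegral.integral_congr_ae ?_
  have h1 : ∀ᵐ x : ℝ ∂volume, x ≠ 1 := by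
    simp [ae_iff, measure_singleton]
  filter_upwards [h1] with x hx1 hx
  rw [uIoc_of_le (by norm_num)] at hx
  have hx' : x ∈ Ioo (-1:ℝ) 1 := ⟨hx.1, lt_of_le_of_ne hx.2 hx1⟩
  rw [jacobiP, iter_eq _ _ _ x hx', jacobiWeight, Real.rpow_neg (by linarith [hx.2]),
    Real.rpow_neg (by linarith [hx.1])]
  have p1 : 0 < (1 - x)^α := Real.rpow_pos_of_pos (by linarith [hx'.2]) _
  have p2 : 0 < (1 + x)^β := Real.rpow_pos_of_pos (by linarith [hx'.1]) _
  field_simp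

lemma ker_exists (α β : ℝ) (hα : -1 < α) (hβ : -1 < β) (d : ℝ) (hd : 0 < d) (hd1 : d < 1)
    (K : ℕ) : ∃ C : ℝ, 0 < C ∧ ∃ N : ℕ, ∀ n ≥ N, ∃ φ : ℕ → ℝ → ℝ, Ker K C d n φ ∧
      ∀ f : ℝ → ℝ, |jacobiCoeff α β n f| ≤ C * Real.sqrt n * |∫ x in (-1:ℝ)..1, f x * φ 0 x| := by
  obtain ⟨c, hc, N1, hσ⟩ := sigma_lower α β hα hβ
  set B : ℝ := |α| + |β| + K + 2 with hB
  have hB0 : 0 ≤ B := by positivity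
  obtain ⟨C1, hC1, hloc⟩ := R_local hd hd1 hB0
  set W : ℝ := ∫ x in (-1:ℝ)..1, (1 - x) ^ (α + K) * (1 + x) ^ (β + K) with hW
  have hKr : (0:ℝ) ≤ K := by positivity
  have hW0 : 0 ≤ W := by
    refine intervalIntegral.integral_nonneg (by norm_num) (fun x hx => ?_)
    exact mul_nonneg (Real.rpow_nonneg (by linarith [hx.2]) _) (Real.rpow_nonneg (by linarith [hx.1]) _)
  set Ca : ℝ := (2/d)^B * (2/d)^B * Real.sqrt C1 * 2^K with hCa
  set Cb : ℝ := (W + 1) * 2^K with hCb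
  set Cc : ℝ := Real.sqrt (1/c) with hCc
  have hCa0 : 0 < Ca := by positivity
  have hCb0 : 0 < Cb := by positivity
  have hCc0 : 0 < Cc := by positivity
  refine ⟨Ca + Cb + Cc, by positivity, N1 + 2 * K + 2, fun n hn => ?_⟩
  have hn1 : (1:ℝ) ≤ n := by exact_mod_cast (show 1 ≤ n by omega)
  have hn0 : (0:ℝ) < n := by linarith
  set Nn := Nrm (n+α) (n+β) n with hNn
  have hNpos : ∀ k ≤ n, 0 < Nrm (n+α) (n+β) (n-k) := fun k hk =>
    Nrm_pos _ _ (by linarith) (by linarith) _ (by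
      intro i hi
      have : (i:ℝ) + 1 ≤ n := by exact_mod_cast (show i + 1 ≤ n by omega)
      constructor <;> linarith)
  have hNn0 : 0 < Nn := by simpa using hNpos 0 (by omega)
  have hsq : 0 < Real.sqrt Nn := Real.sqrt_pos.mpr hNn0
  -- the bound on the square roots of the norms
  have hroot : ∀ k ≤ K, Real.sqrt (Nrm (n+α) (n+β) (n-k)) ≤ 2^K * ((n:ℝ)^k)⁻¹ * Real.sqrt Nn := by
    intro k hk
    have h1 := Nrm_ratio α β hα hβ K n (by omega) k hk
    refine Real.sqrt_le_iff.mpr ⟨by positivity, ?_⟩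
    rw [mul_pow, Real.sq_sqrt hNn0.le, mul_pow, inv_pow]
    have h2 : Nrm (n+α) (n+β) (n-k) ≤ (((n:ℝ)^k)^2)⁻¹ * (4^k * Nn) := by
      rw [inv_mul_eq_div, le_div_iff₀ (by positivity)]
      linarith
    refine h2.trans ?_
    have h3 : (4:ℝ)^k ≤ (2^K)^2 := by
      rw [← pow_mul, mul_comm K 2, pow_mul]; norm_num
      exact pow_le_pow_right₀ (by norm_num) hk
    calc (((n:ℝ)^k)^2)⁻¹ * (4^k * Nn) ≤ (((n:ℝ)^k)^2)⁻¹ * ((2^K)^2 * Nn) := by gcongr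
      _ = _ := by ring
  have hexp : ∀ k ≤ n, (n:ℝ) + α - ((n-k:ℕ):ℝ) = α + k ∧ (n:ℝ) + β - ((n-k:ℕ):ℝ) = β + k := by
    intro k hk
    rw [Nat.cast_sub hk]; constructor <;> ring
  have hk1 : ∀ k < K, n - (k+1) + 1 = n - k := fun k hk => by omega
  refine ⟨fun k y => V (n+α) (n+β) (n-k) y / Real.sqrt Nn, ⟨?_, ?_, ?_, ?_, ?_, ?_, ?_⟩, ?_⟩
  · intro k hk y hy
    have := V_deriv (n+α) (n+β) (n-(k+1)) hy
    rw [hk1 k hk] at this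
    exact this.div_const _
  · intro k hk
    obtain ⟨e1, e2⟩ := hexp (k+1) (by omega)
    refine (V_cont _ _ _ ?_ ?_).div_const _
    · rw [e1]; push_cast; have : (0:ℝ) ≤ k := by positivity
      linarith
    · rw [e2]; push_cast; have : (0:ℝ) ≤ k := by positivity
      linarith
  · intro k hk
    obtain ⟨e1, e2⟩ := hexp (k+1) (by omega)
    rw [V_one, zero_div]
    rw [e1]; push_cast; have : (0:ℝ) ≤ k := by positivity
    linarith
  · intro k hk
    obtain ⟨e1, e2⟩ := hexp (k+1) (by omega)
    rw [V_neg_one, zero_div]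
    rw [e2]; push_cast; have : (0:ℝ) ≤ k := by positivity
    linarith
  · refine (V_int _ _ _ ?_ ?_).div_const _
    · simpa using hα
    · simpa using hβ
  · intro k hk y hy
    have hkr : (k:ℝ) ≤ K := by exact_mod_cast hk
    have hk0 : (0:ℝ) ≤ k := by positivity
    obtain ⟨e1, e2⟩ := hexp k (by omega)
    obtain ⟨e1', e2'⟩ := hexp (k+1) (by omega)
    obtain ⟨J, hJ⟩ : ∃ J, n - (k+1) = J := ⟨_, rfl⟩
    have hJ1 : n - k = J + 1 := by omega
    rw [hJ] at e1' e2'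
    rw [hJ1] at e1 e2
    have bα : ∀ r : ℝ, 0 ≤ r → r ≤ K + 1 → |α + r| ≤ B := fun r h0 h1 => by
      refine (abs_add_le _ _).trans ?_
      rw [abs_of_nonneg h0]; have := abs_nonneg β; linarith
    have bβ : ∀ r : ℝ, 0 ≤ r → r ≤ K + 1 → |β + r| ≤ B := fun r h0 h1 => by
      refine (abs_add_le _ _).trans ?_
      rw [abs_of_nonneg h0]; have := abs_nonneg α; linarith
    have hR := hloc (n+α) (n+β) J (by rw [e1']; push_cast; linarith)
      (by rw [e2']; push_cast; linarith)
      (by rw [e1']; push_cast; exact bα _ (by linarith) (by linarith))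
      (by rw [e2']; push_cast; exact bβ _ (by linarith) (by linarith))
      (by rw [e1]; exact bα _ (by linarith) (by linarith))
      (by rw [e2]; exact bβ _ (by linarith) (by linarith)) y hy
    have hy' := abs_le.mp hy
    have w1 : (1 - y) ^ (α + k) ≤ (2/d)^B :=
      pw_upper hd hd1.le (by linarith) (by linarith) (bα _ (by linarith) (by linarith))
    have w2 : (1 + y) ^ (β + k) ≤ (2/d)^B :=
      pw_upper hd hd1.le (by linarith) (by linarith) (bβ _ (by linarith) (by linarith))
    have w10 : 0 ≤ (1 - y) ^ (α + k) := Real.rpow_nonneg (by linarith) _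
    have w20 : 0 ≤ (1 + y) ^ (β + k) := Real.rpow_nonneg (by linarith) _
    have hRs : |(Rp (n+α) (n+β) (J+1)).eval y| ≤ Real.sqrt C1 * (2^K * ((n:ℝ)^k)⁻¹ * Real.sqrt Nn) := by
      have := Real.abs_le_sqrt hR
      refine this.trans ?_
      rw [Real.sqrt_mul hC1.le, ← hJ1]
      gcongr
      exact hroot k hk
    simp only [hJ1]
    rw [abs_div, abs_of_pos hsq, div_le_iff₀ hsq, V, e1, e2, abs_mul, abs_mul, abs_of_nonneg w10,
      abs_of_nonneg w20]
    calc (1 - y) ^ (α + k) * (1 + y) ^ (β + k) * |(Rp (n+α) (n+β) (J+1)).eval y|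
        ≤ (2/d)^B * (2/d)^B * (Real.sqrt C1 * (2^K * ((n:ℝ)^k)⁻¹ * Real.sqrt Nn)) := by gcongr
      _ = Ca * ((n:ℝ)^k)⁻¹ * Real.sqrt Nn := by rw [hCa]; ring
      _ ≤ (Ca + Cb + Cc) * ((n:ℝ)^k)⁻¹ * Real.sqrt Nn := by gcongr; linarith
  · obtain ⟨e1, e2⟩ := hexp K (by omega)
    set s := Real.sqrt (Nrm (n+α) (n+β) (n-K)) with hs
    have hNK := hNpos K (by omega)
    have hs0 : 0 < s := Real.sqrt_pos.mpr hNK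
    have hss : s * s = Nrm (n+α) (n+β) (n-K) := Real.mul_self_sqrt hNK.le
    have iw := weight_int (p := α + K) (q := β + K) (by linarith) (by linarith)
    have iV : IntervalIntegrable (V (n+α) (n+β) (n-K)) volume (-1) 1 :=
      V_int _ _ _ (by rw [e1]; linarith) (by rw [e2]; linarith)
    have iRV : IntervalIntegrable (fun y => (Rp (n+α) (n+β) (n-K)).eval y * V (n+α) (n+β) (n-K) y)
        volume (-1) 1 := iV.continuousOn_mul (Polynomial.continuous _).continuousOn
    have hmono := intervalIntegral.integral_mono_on (a := -1) (b := 1) (by norm_num)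
      (f := fun y => |V (n+α) (n+β) (n-K) y|)
      (g := fun y => s * ((1 - y) ^ (α + K) * (1 + y) ^ (β + K)) +
        s⁻¹ * ((Rp (n+α) (n+β) (n-K)).eval y * V (n+α) (n+β) (n-K) y)) iV.abs
      ((iw.const_mul _).add (iRV.const_mul _)) (fun y hy => by
        have w10 : 0 ≤ (1 - y) ^ (α + K) := Real.rpow_nonneg (by linarith [hy.2]) _
        have w20 : 0 ≤ (1 + y) ^ (β + K) := Real.rpow_nonneg (by linarith [hy.1]) _
        rw [V, e1, e2, abs_mul, abs_of_nonneg (mul_nonneg w10 w20)]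
        set r := (Rp (n+α) (n+β) (n-K)).eval y
        set ω := (1 - y) ^ (α + K) * (1 + y) ^ (β + K)
        have hω : 0 ≤ ω := mul_nonneg w10 w20
        have : |r| ≤ s + s⁻¹ * r^2 := by
          rw [inv_mul_eq_div, ← sub_nonneg]
          have : s + r^2/s - |r| = ((s - |r|/2)^2 + 3/4 * |r|^2) / s := by
            rw [← sq_abs r]; field_simp; ring
          rw [this]; positivity
        calc ω * |r| ≤ ω * (s + s⁻¹ * r^2) := by gcongr
          _ = _ := by ring)
    rw [intervalIntegral.integral_add (iw.const_mul _) (iRV.const_mul _),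
      intervalIntegral.integral_const_mul, intervalIntegral.integral_const_mul] at hmono
    change _ ≤ s * W + s⁻¹ * Nrm (n+α) (n+β) (n-K) at hmono
    have e3 : s * W + s⁻¹ * Nrm (n+α) (n+β) (n-K) = s * (W + 1) := by
      rw [← hss]; field_simp
    rw [e3] at hmono
    simp only [abs_div, abs_of_pos hsq, intervalIntegral.integral_div]
    rw [div_le_iff₀ hsq]
    calc _ ≤ s * (W + 1) := hmono
      _ ≤ (2^K * ((n:ℝ)^K)⁻¹ * Real.sqrt Nn) * (W + 1) := by gcongr; exact hroot K le_rfl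
      _ = Cb * ((n:ℝ)^K)⁻¹ * Real.sqrt Nn := by rw [hCb]; ring
      _ ≤ _ := by gcongr; linarith
  · intro f
    rw [coeff_eq]
    simp only [Nat.sub_zero, mul_div_assoc']
    rw [intervalIntegral.integral_div]
    set I := ∫ x in (-1:ℝ)..1, f x * V (n+α) (n+β) n x
    have hσn := hσ n (by omega)
    have hσ0 : 0 < jacobiSigma α β n := lt_of_lt_of_le (by positivity) hσn
    have hNσ := Nrm_sigma α β hα hβ n (by omega)
    have hsN : Real.sqrt Nn = 2 ^ n * (n.factorial : ℝ) * Real.sqrt (jacobiSigma α β n) := by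
      rw [hNn, hNσ, Real.sqrt_mul (by positivity), Real.sqrt_sq (by positivity)]
    set σ := jacobiSigma α β n
    have hsσ : 0 < Real.sqrt σ := Real.sqrt_pos.mpr hσ0
    have hσσ : Real.sqrt σ * Real.sqrt σ = σ := Real.mul_self_sqrt hσ0.le
    have e : |1 / σ * ((-1) ^ n / (2 ^ n * (n.factorial : ℝ)) * I)| = (1 / Real.sqrt σ) * |I / Real.sqrt Nn| := by
      rw [abs_mul, abs_mul, abs_div, abs_div, abs_div, abs_pow, abs_neg, abs_one, one_pow, hsN,
        abs_of_pos hσ0, abs_of_pos (show 0 < 2 ^ n * (n.factorial : ℝ) by positivity),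
        abs_of_pos (show 0 < 2 ^ n * (n.factorial : ℝ) * Real.sqrt σ by positivity)]
      nth_rw 1 [← hσσ]
      field_simp
    have e' : |1 / σ * ((-1) ^ n * I / (2 ^ n * (n.factorial : ℝ)))| = (1 / Real.sqrt σ) * |I / Real.sqrt Nn| := by
      rw [← e]; ring_nf
    have hfin : 1 / Real.sqrt σ ≤ (Ca + Cb + Cc) * Real.sqrt n := by
      have : 1 / Real.sqrt σ ≤ Cc * Real.sqrt n := by
        have e5 : 1 / Real.sqrt σ = Real.sqrt (1 / σ) := by
          rw [Real.sqrt_div' _ hσ0.le, Real.sqrt_one]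
        rw [e5, hCc, ← Real.sqrt_mul (by positivity)]
        apply Real.sqrt_le_sqrt
        rw [div_le_iff₀ hn0] at hσn
        rw [div_le_iff₀ hσ0, div_mul_eq_mul_div, one_mul, div_mul_eq_mul_div, le_div_iff₀ hc]
        linarith
      refine this.trans ?_
      gcongr; linarith
    have := mul_le_mul_of_nonneg_right hfin (abs_nonneg (I / Real.sqrt Nn))
    first
      | (rw [e]; exact this)
      | (rw [e']; exact this)
      | (ring_nf at e e' this ⊢; linarith)

end JacAux


namespace JacAux

/-- Boundary terms in repeated integration by parts. -/
noncomputable def Bd (u φ : ℕ → ℝ → ℝ) (m : ℕ) (y : ℝ) : ℝ :=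
  ∑ k ∈ Finset.range m, (-1 : ℝ) ^ k * (u k y * φ (k+1) y)

section
variable {K : ℕ} {C d ν a : ℝ} {φ : ℕ → ℝ → ℝ}

lemma Ker.int (hφ : Ker K C d ν φ) {p q : ℝ} (hp : -1 ≤ p) (hpq : p ≤ q) (hq : q ≤ 1)
    {k : ℕ} (hk : k ≤ K) : IntervalIntegrable (φ k) volume p q := by
  rcases k with _ | k
  · refine hφ.int0.mono_set ?_
    rw [uIcc_of_le hpq, uIcc_of_le (by norm_num)]
    exact Icc_subset_Icc hp hq
  · exact (hφ.cont k (by omega)).intervalIntegrable _ _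

lemma Bd_one (hφ : Ker K C d ν φ) (u : ℕ → ℝ → ℝ) : Bd u φ K 1 = 0 := by
  refine Finset.sum_eq_zero (fun k hk => ?_)
  rw [hφ.one k (Finset.mem_range.mp hk)]; simp

lemma Bd_neg_one (hφ : Ker K C d ν φ) (u : ℕ → ℝ → ℝ) : Bd u φ K (-1) = 0 := by
  refine Finset.sum_eq_zero (fun k hk => ?_)
  rw [hφ.neg_one k (Finset.mem_range.mp hk)]; simp

lemma ibp (hφ : Ker K C d ν φ) {p q : ℝ} (hp : -1 ≤ p) (hpq : p ≤ q) (hq : q ≤ 1)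
    {u : ℕ → ℝ → ℝ} (hu : ∀ k < K, ∀ y ∈ Icc p q, HasDerivAt (u k) (u (k+1) y) y)
    (huK : ContinuousOn (u K) (Icc p q)) : ∀ m ≤ K,
    ∫ y in p..q, u 0 y * φ 0 y =
      Bd u φ m q - Bd u φ m p + (-1) ^ m * ∫ y in p..q, u m y * φ m y := by
  have hcont : ∀ k ≤ K, ContinuousOn (u k) (Icc p q) := by
    intro k hk
    rcases Nat.lt_or_ge k K with h | h
    · exact fun y hy => (hu k h y hy).continuousAt.continuousWithinAt
    · obtain rfl : k = K := by omega
      exact huK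
  intro m
  induction m with
  | zero => intro _; simp [Bd]
  | succ m ih =>
    intro hm
    rw [ih (by omega)]
    have hpart := intervalIntegral.integral_mul_deriv_eq_deriv_mul_of_hasDerivAt
      (a := p) (b := q) (u := u m) (u' := u (m+1)) (v := φ (m+1)) (v' := φ m)
      (by rw [uIcc_of_le hpq]; exact hcont m (by omega))
      (hφ.cont m (by omega)).continuousOn
      (fun y hy => by
        rw [min_eq_left hpq, max_eq_right hpq] at hy
        exact hu m (by omega) y (Ioo_subset_Icc_self hy))
      (fun y hy => by
        rw [min_eq_left hpq, max_eq_right hpq] at hy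
        exact hφ.der m (by omega) y ⟨by linarith [hy.1], by linarith [hy.2]⟩)
      (by
        refine ContinuousOn.intervalIntegrable ?_
        rw [uIcc_of_le hpq]; exact hcont (m+1) hm)
      (hφ.int hp hpq hq (by omega))
    rw [hpart, Bd, Bd, Bd, Bd, Finset.sum_range_succ, Finset.sum_range_succ]
    ring

lemma rem_aux (hφ : Ker K C d ν φ) (hK : 1 ≤ K) (hC : 0 < C) (hd : 0 < d) (ha : |a| ≤ 1 - 2 * d)
    (hν : 1 ≤ ν) :
    ∫ y in (-1:ℝ)..1, |φ K y| * (1 + (ν * (y - a))^2)⁻¹ ≤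
      C * (Real.pi + (d^2)⁻¹) * (ν^K)⁻¹ * ν⁻¹ := by
  have hν0 : 0 < ν := by linarith
  have hcK : Continuous (φ K) := by
    obtain ⟨k, rfl⟩ : ∃ k, K = k + 1 := ⟨K - 1, by omega⟩
    exact hφ.cont k (by omega)
  have hc2 : Continuous (fun y => (1 + (ν * (y - a))^2)⁻¹) :=
    Continuous.inv₀ (by fun_prop) (fun y => by positivity)
  have hmono := intervalIntegral.integral_mono_on (a := -1) (b := 1) (μ := volume) (by norm_num)
    (f := fun y => |φ K y| * (1 + (ν * (y - a))^2)⁻¹)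
    (g := fun y => C * (ν^K)⁻¹ * (1 + (ν * (y - a))^2)⁻¹ + (ν^2 * d^2)⁻¹ * |φ K y|)
    (Continuous.intervalIntegrable (by fun_prop) _ _)
    (Continuous.intervalIntegrable (by fun_prop) _ _) (fun y hy => by
      by_cases h : |y - a| ≤ d
      · have h1 : |y| ≤ 1 - d := by
          have := abs_add_le (y - a) a
          rw [sub_add_cancel] at this; linarith
        have h2 := hφ.loc K le_rfl y h1
        have : 0 ≤ (ν^2 * d^2)⁻¹ * |φ K y| := by positivity
        have h3 : |φ K y| * (1 + (ν * (y - a))^2)⁻¹ ≤ C * (ν^K)⁻¹ * (1 + (ν * (y - a))^2)⁻¹ := by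
          gcongr
        linarith
      · push Not at h
        have h3 : d^2 ≤ (y-a)^2 := by rw [← sq_abs (y-a)]; gcongr
        have h2 : (1 + (ν * (y - a))^2)⁻¹ ≤ (ν^2 * d^2)⁻¹ := by
          apply inv_anti₀ (by positivity)
          rw [mul_pow]; nlinarith [sq_nonneg ν]
        have : 0 ≤ C * (ν^K)⁻¹ * (1 + (ν * (y - a))^2)⁻¹ := by positivity
        have h4 : |φ K y| * (1 + (ν * (y - a))^2)⁻¹ ≤ (ν^2 * d^2)⁻¹ * |φ K y| := by
          rw [mul_comm]; gcongr
        linarith)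
  refine hmono.trans ?_
  rw [intervalIntegral.integral_add (Continuous.intervalIntegrable (by fun_prop) _ _)
    (Continuous.intervalIntegrable (by fun_prop) _ _), intervalIntegral.integral_const_mul,
    intervalIntegral.integral_const_mul]
  have hpi : ∫ y in (-1:ℝ)..1, (1 + (ν * (y - a))^2)⁻¹ ≤ Real.pi * ν⁻¹ := by
    have e1 := intervalIntegral.integral_comp_mul_sub (a := -1) (b := 1)
      (fun x : ℝ => (1 + x^2)⁻¹) hν0.ne' (ν * a)
    have e2 : ∀ y : ℝ, ν * (y - a) = ν * y - ν * a := fun y => by ring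
    simp only [e2]
    rw [e1, smul_eq_mul, mul_comm]
    gcongr
    rw [intervalIntegral.integral_of_le (by nlinarith), ← integral_univ_inv_one_add_sq]
    refine setIntegral_le_integral integrable_inv_one_add_sq ?_
    exact Filter.Eventually.of_forall (fun x => by positivity)
  have h5 : (ν^2 * d^2)⁻¹ ≤ ν⁻¹ * (d^2)⁻¹ := by
    rw [mul_inv]; gcongr; nlinarith
  calc C * (ν^K)⁻¹ * (∫ y in (-1:ℝ)..1, (1 + (ν * (y - a))^2)⁻¹)
        + (ν^2 * d^2)⁻¹ * ∫ y in (-1:ℝ)..1, |φ K y|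
      ≤ C * (ν^K)⁻¹ * (Real.pi * ν⁻¹) + (ν⁻¹ * (d^2)⁻¹) * (C * (ν^K)⁻¹) := by
        gcongr
        · exact intervalIntegral.integral_nonneg (by norm_num) (fun y _ => abs_nonneg _)
        · exact hφ.l1
    _ = _ := by ring

lemma max_bound {μ t : ℝ} (hμ : μ + 2 ≤ K) (hν : 1 ≤ ν) :
    (max |t| ν⁻¹)^(μ - K) ≤ 2 * ν^(K - μ) * (1 + (ν * t)^2)⁻¹ := by
  have hν0 : 0 < ν := by linarith
  rw [← div_eq_mul_inv, le_div_iff₀ (by positivity)]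
  have e : max |t| ν⁻¹ = ν⁻¹ * max (ν * |t|) 1 := by
    rw [mul_max_of_nonneg _ _ (by positivity), mul_one, inv_mul_cancel_left₀ hν0.ne']
  have hw : 1 ≤ max (ν * |t|) 1 := le_max_right _ _
  set w := max (ν * |t|) 1
  rw [e, Real.mul_rpow (by positivity) (by positivity), Real.inv_rpow hν0.le, ← Real.rpow_neg hν0.le,
    neg_sub]
  have h1 : w^(μ - K) ≤ (w^2)⁻¹ := by
    rw [← Real.rpow_natCast, ← Real.rpow_neg (by positivity)]
    apply Real.rpow_le_rpow_of_exponent_le hw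
    push_cast; linarith
  have h2 : 1 + (ν*t)^2 ≤ 2 * w^2 := by
    have : (ν*t)^2 ≤ w^2 := by
      rw [← sq_abs (ν*t), abs_mul, abs_of_pos hν0]
      gcongr; exact le_max_left _ _
    nlinarith
  calc ν^(K - μ) * w^(μ - K) * (1 + (ν*t)^2) ≤ ν^(K - μ) * (w^2)⁻¹ * (2 * w^2) := by gcongr
    _ = 2 * ν^(K-μ) := by field_simp

/-- remainder estimate -/
lemma rem_est (hφ : Ker K C d ν φ) (hK : 1 ≤ K) (hC : 0 < C) (hd : 0 < d) (ha : |a| ≤ 1 - 2 * d)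
    (hν : 1 ≤ ν) {p q : ℝ} (hp : -1 ≤ p) (hpq : p ≤ q) (hq : q ≤ 1) {μ M : ℝ} (hμ : μ + 2 ≤ K)
    (hM : 0 ≤ M) {u : ℝ → ℝ} (hu : ∀ y ∈ Icc p q, |u y| ≤ M * (max |y - a| ν⁻¹)^(μ - K)) :
    |∫ y in p..q, u y * φ K y| ≤ M * (2 * C * (Real.pi + (d^2)⁻¹)) * ν^(-μ - 1) := by
  have hν0 : 0 < ν := by linarith
  have hcK : Continuous (φ K) := by
    obtain ⟨k, rfl⟩ : ∃ k, K = k + 1 := ⟨K - 1, by omega⟩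
    exact hφ.cont k (by omega)
  have hc2 : Continuous (fun y => (1 + (ν * (y - a))^2)⁻¹) :=
    Continuous.inv₀ (by fun_prop) (fun y => by positivity)
  have hcc : Continuous (fun y => |φ K y| * (1 + (ν * (y - a))^2)⁻¹) := by fun_prop
  have h1 := intervalIntegral.norm_integral_le_of_norm_le (μ := volume) hpq
    (f := fun y => u y * φ K y)
    (g := fun y => M * (2 * ν^(K - μ)) * (|φ K y| * (1 + (ν * (y - a))^2)⁻¹))
    (Filter.Eventually.of_forall (fun y hy => by
      rw [Real.norm_eq_abs, abs_mul]
      have h2 := hu y (Ioc_subset_Icc_self hy)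
      have h3 := max_bound (t := y - a) hμ hν
      calc |u y| * |φ K y| ≤ (M * (2 * ν^(K - μ) * (1 + (ν * (y-a))^2)⁻¹)) * |φ K y| := by
            gcongr; exact h2.trans (by gcongr)
        _ = _ := by ring))
    (Continuous.intervalIntegrable (by fun_prop) _ _)
  rw [Real.norm_eq_abs, intervalIntegral.integral_const_mul] at h1
  have h4 : ∫ y in p..q, |φ K y| * (1 + (ν * (y - a))^2)⁻¹ ≤
      ∫ y in (-1:ℝ)..1, |φ K y| * (1 + (ν * (y - a))^2)⁻¹ := by
    apply intervalIntegral.integral_mono_interval hp hpq hq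
    · exact Filter.Eventually.of_forall (fun y => by positivity)
    · exact hcc.intervalIntegrable _ _
  have h5 := rem_aux hφ hK hC hd ha hν
  refine h1.trans ?_
  calc _ ≤ M * (2 * ν^(K - μ)) * (C * (Real.pi + (d^2)⁻¹) * (ν^K)⁻¹ * ν⁻¹) := by
        gcongr; exact h4.trans h5
    _ = M * (2 * C * (Real.pi + (d^2)⁻¹)) * (ν^(K - μ) * (ν^K)⁻¹ * ν⁻¹) := by ring
    _ = _ := by
        congr 1
        rw [← Real.rpow_natCast, ← Real.rpow_neg hν0.le, ← Real.rpow_neg_one, ← Real.rpow_add hν0,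
          ← Real.rpow_add hν0]
        congr 1; ring

/-- integration by parts with remainder estimate -/
lemma ibp_est (hφ : Ker K C d ν φ) (hK : 1 ≤ K) (hC : 0 < C) (hd : 0 < d) (ha : |a| ≤ 1 - 2 * d)
    (hν : 1 ≤ ν) {p q : ℝ} (hp : -1 ≤ p) (hpq : p ≤ q) (hq : q ≤ 1) {μ M : ℝ} (hμ : μ + 2 ≤ K)
    (hM : 0 ≤ M) {u : ℕ → ℝ → ℝ} (hu : ∀ k < K, ∀ y ∈ Icc p q, HasDerivAt (u k) (u (k+1) y) y)
    (huK : ContinuousOn (u K) (Icc p q))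
    (hb : ∀ y ∈ Icc p q, |u K y| ≤ M * (max |y - a| ν⁻¹)^(μ - K)) :
    |(∫ y in p..q, u 0 y * φ 0 y) - (Bd u φ K q - Bd u φ K p)| ≤
      M * (2 * C * (Real.pi + (d^2)⁻¹)) * ν^(-μ - 1) := by
  rw [ibp hφ hp hpq hq hu huK K le_rfl, add_sub_cancel_left, abs_mul, abs_pow, abs_neg, abs_one,
    one_pow, one_mul]
  exact rem_est hφ hK hC hd ha hν hp hpq hq hμ hM hb

lemma Bd_est (hφ : Ker K C d ν φ) (hC : 0 < C) (hν : 1 ≤ ν) {μ M y : ℝ} (hM : 0 ≤ M)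
    {u : ℕ → ℝ → ℝ} (hy : |y| ≤ 1 - d) (hu : ∀ k < K, |u k y| ≤ M * ν^(k - μ)) :
    |Bd u φ K y| ≤ M * (K * C) * ν^(-μ - 1) := by
  have hν0 : 0 < ν := by linarith
  refine (Finset.abs_sum_le_sum_abs _ _).trans ?_
  have : ∀ k ∈ Finset.range K, |(-1 : ℝ) ^ k * (u k y * φ (k+1) y)| ≤ M * C * ν^(-μ-1) := by
    intro k hk
    have hk' := Finset.mem_range.mp hk
    rw [abs_mul, abs_pow, abs_neg, abs_one, one_pow, one_mul, abs_mul]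
    calc |u k y| * |φ (k+1) y| ≤ (M * ν^(k - μ)) * (C * (ν^(k+1))⁻¹) := by
          gcongr
          · exact hu k hk'
          · exact hφ.loc (k+1) hk' y hy
      _ = M * C * (ν^(k - μ) * (ν^(k+1))⁻¹) := by ring
      _ = _ := by
        congr 1
        rw [← Real.rpow_natCast, ← Real.rpow_neg hν0.le, ← Real.rpow_add hν0]
        congr 1; push_cast; ring
  refine (Finset.sum_le_sum this).trans ?_
  rw [Finset.sum_const, Finset.card_range, nsmul_eq_mul]
  apply le_of_eq; ring

lemma int_abs_rpow {μ s : ℝ} (hμ : -1 < μ) (hs : 0 ≤ s) :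
    IntervalIntegrable (fun y : ℝ => |y - a|^μ) volume (a - s) (a + s) ∧
    ∫ y in (a - s)..(a + s), |y - a|^μ = 2 * s^(μ+1) / (μ+1) := by
  have i1 : IntervalIntegrable (fun y : ℝ => |y|^μ) volume 0 s := by
    refine (intervalIntegral.intervalIntegrable_rpow' (a := 0) (b := s) hμ).congr (fun y hy => ?_)
    rw [uIoc_of_le hs] at hy
    simp [abs_of_pos hy.1]
  have e1 : ∫ y in (0:ℝ)..s, |y|^μ = s^(μ+1)/(μ+1) := by
    have : ∫ y in (0:ℝ)..s, |y|^μ = ∫ y in (0:ℝ)..s, y^μ := by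
      refine intervalIntegral.integral_congr (fun y hy => ?_)
      rw [uIcc_of_le hs] at hy
      simp [abs_of_nonneg hy.1]
    rw [this, integral_rpow (Or.inl hμ), Real.zero_rpow (by linarith), sub_zero]
  have i2 : IntervalIntegrable (fun y : ℝ => |y|^μ) volume (-s) 0 := by
    have := i1.comp_mul_left (c := -1)
    simp at this
    simpa [div_neg] using this.symm
  have e2 : ∫ y in (-s)..0, |y|^μ = s^(μ+1)/(μ+1) := by
    have := intervalIntegral.integral_comp_neg (a := 0) (b := s) (fun y : ℝ => |y|^μ)
    simp only [abs_neg, neg_zero] at this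
    rw [← this, e1]
  have i3 := i2.trans i1
  constructor
  · have := i3.comp_sub_right a
    convert this using 1 <;> ring
  · have := intervalIntegral.integral_comp_sub_right (a := a - s) (b := a + s) (fun y : ℝ => |y|^μ) a
    rw [this]
    have e3 : a - s - a = -s := by ring
    have e4 : a + s - a = s := by ring
    rw [e3, e4, ← intervalIntegral.integral_add_adjacent_intervals i2 i1, e1, e2]
    ring

/-- crude estimate near the singular point -/
lemma crude (hφ : Ker K C d ν φ) (hC : 0 < C) (ha : |a| ≤ 1 - 2 * d) {μ M s p q : ℝ} (hμ : -1 < μ)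
    (hM : 0 ≤ M) (hs : 0 < s) (hsd : s ≤ d) (hp : a - s ≤ p) (hpq : p ≤ q) (hq : q ≤ a + s)
    {u : ℝ → ℝ} (hu : ∀ y ∈ Ioo p q, y ≠ a → |u y| ≤ M * (|y - a|^μ + s^μ)) :
    |∫ y in p..q, u y * φ 0 y| ≤ M * (C * (2 * (1 / (μ + 1) + 1))) * s^(μ + 1) := by
  obtain ⟨i1, e1⟩ := int_abs_rpow (a := a) hμ hs.le
  have i2 : IntervalIntegrable (fun y : ℝ => C * M * (|y - a|^μ + s^μ)) volume (a - s) (a + s) :=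
    (i1.add intervalIntegrable_const).const_mul _
  have i3 : IntervalIntegrable (fun y : ℝ => C * M * (|y - a|^μ + s^μ)) volume p q := by
    refine i2.mono_set ?_
    rw [uIcc_of_le hpq, uIcc_of_le (by linarith)]
    exact Icc_subset_Icc hp hq
  have n1 : ∀ᵐ x : ℝ ∂volume, x ≠ a := by simp [ae_iff, measure_singleton]
  have n2 : ∀ᵐ x : ℝ ∂volume, x ≠ q := by simp [ae_iff, measure_singleton]
  have h1 := intervalIntegral.norm_integral_le_of_norm_le (μ := volume) hpq
    (f := fun y => u y * φ 0 y) (g := fun y => C * M * (|y - a|^μ + s^μ)) (by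
      filter_upwards [n1, n2] with y hya hyq hy
      have h2 := hu y ⟨hy.1, lt_of_le_of_ne hy.2 hyq⟩ hya
      have h3 : |y| ≤ 1 - d := by
        have := abs_add_le (y - a) a
        rw [sub_add_cancel] at this
        have h4 : |y - a| ≤ s := abs_le.mpr ⟨by linarith [hy.1], by linarith [hy.2]⟩
        linarith
      have h4 := hφ.loc 0 (by omega) y h3
      simp only [pow_zero, inv_one, mul_one] at h4
      rw [Real.norm_eq_abs, abs_mul]
      have h5 : 0 ≤ |y - a|^μ + s^μ := by positivity
      calc |u y| * |φ 0 y| ≤ (M * (|y - a|^μ + s^μ)) * C := by gcongr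
        _ = _ := by ring) i3
  rw [Real.norm_eq_abs] at h1
  refine h1.trans ?_
  have h6 := intervalIntegral.integral_mono_interval hp hpq hq
    (f := fun y : ℝ => C * M * (|y - a|^μ + s^μ))
    (Filter.Eventually.of_forall (fun y => by
      have : 0 ≤ |y - a|^μ + s^μ := by positivity
      positivity)) i2
  refine h6.trans (le_of_eq ?_)
  rw [intervalIntegral.integral_const_mul, intervalIntegral.integral_add i1 intervalIntegrable_const,
    e1, intervalIntegral.integral_const, smul_eq_mul]
  have : s^(μ+1) = s^μ * s := by rw [Real.rpow_add_one hs.ne']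
  rw [this]
  have : μ + 1 ≠ 0 := by linarith
  field_simp
  ring

end
end JacAux


namespace JacAux

lemma smooth_ext (L : ℕ) : ∀ z : ℝ → ℝ, ContDiffOn ℝ (⊤ : ℕ∞) z (Icc (-1:ℝ) 1) →
    ∃ zs : ℕ → ℝ → ℝ, (∀ k < L, ∀ y, HasDerivAt (zs k) (zs (k+1) y) y) ∧
      (∀ k ≤ L, Continuous (zs k)) ∧ ∀ y ∈ Icc (-1:ℝ) 1, zs 0 y = z y := by
  induction L with
  | zero =>
    intro z hz
    refine ⟨fun _ => IccExtend (by norm_num : (-1:ℝ) ≤ 1) ((Icc (-1:ℝ) 1).domRestrict z), by simp, ?_, ?_⟩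
    · intro k _
      exact (continuousOn_iff_continuous_domRestrict.mp hz.continuousOn).Icc_extend'
    · intro y hy
      beta_reduce
      rw [IccExtend_of_mem _ _ hy]; rfl
  | succ L ih =>
    intro z hz
    have hu : UniqueDiffOn ℝ (Icc (-1:ℝ) 1) := uniqueDiffOn_Icc (by norm_num)
    have hz' : ContDiffOn ℝ (⊤ : ℕ∞) (derivWithin z (Icc (-1:ℝ) 1)) (Icc (-1:ℝ) 1) :=
      hz.derivWithin hu (by norm_cast)
    obtain ⟨ws, h1, h2, h3⟩ := ih _ hz'
    refine ⟨fun k => Nat.casesOn k (fun y => z (-1) + ∫ s in (-1:ℝ)..y, ws 0 s) ws, ?_, ?_, ?_⟩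
    · intro k hk y
      rcases k with _ | k
      · refine HasDerivAt.const_add _ ?_
        exact intervalIntegral.integral_hasDerivAt_right
          ((h2 0 (by omega)).intervalIntegrable _ _)
          ((h2 0 (by omega)).stronglyMeasurableAtFilter _ _) (h2 0 (by omega)).continuousAt
      · exact h1 k (by omega) y
    · intro k hk
      rcases k with _ | k
      · exact continuous_const.add (intervalIntegral.continuous_primitive
          (fun a b => (h2 0 (by omega)).intervalIntegrable _ _) _)
      · exact h2 k (by omega)
    · intro y hy
      change z (-1) + ∫ s in (-1:ℝ)..y, ws 0 s = z y
      have := intervalIntegral.integral_eq_sub_of_hasDeriv_right_of_le (a := -1) (b := y) (f := z)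
        (f' := ws 0) hy.1 (hz.continuousOn.mono (Icc_subset_Icc le_rfl hy.2))
        (fun s hs => by
          have hs' : s ∈ Icc (-1:ℝ) 1 := ⟨hs.1.le, by linarith [hs.2, hy.2]⟩
          have hd := (hz.differentiableOn (by simp) s hs').hasDerivWithinAt
          rw [← h3 s hs'] at hd
          exact (hd.hasDerivAt (Icc_mem_nhds hs.1 (by linarith [hs.2, hy.2]))).hasDerivWithinAt)
        ((h2 0 (by omega)).intervalIntegrable _ _)
      rw [this]; ring

/-- Leibniz product of derivative sequences. -/
noncomputable def mulSeq (u v : ℕ → ℝ → ℝ) (k : ℕ) (y : ℝ) : ℝ :=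
  ∑ i ∈ Finset.range (k+1), (k.choose i : ℝ) * (u i y * v (k - i) y)

lemma mulSeq_zero (u v : ℕ → ℝ → ℝ) (y : ℝ) : mulSeq u v 0 y = u 0 y * v 0 y := by
  simp [mulSeq]

lemma mulSeq_deriv {u v : ℕ → ℝ → ℝ} {k : ℕ} {y : ℝ}
    (hu : ∀ i ≤ k, HasDerivAt (u i) (u (i+1) y) y) (hv : ∀ i ≤ k, HasDerivAt (v i) (v (i+1) y) y) :
    HasDerivAt (mulSeq u v k) (mulSeq u v (k+1) y) y := by
  have h : HasDerivAt (mulSeq u v k) (∑ i ∈ Finset.range (k+1), (k.choose i : ℝ) *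
      (u (i+1) y * v (k-i) y + u i y * v (k - i + 1) y)) y := by
    unfold mulSeq
    refine HasDerivAt.fun_sum (fun i hi => ?_)
    exact ((hu i (by grind)).mul (hv (k-i) (by grind))).const_mul _
  convert h using 1
  unfold mulSeq
  rw [Finset.sum_choose_succ_mul (fun i j => u i y * v j y) k, ← Finset.sum_add_distrib]
  refine Finset.sum_congr rfl (fun i hi => ?_)
  have : k + 1 - i = k - i + 1 := by grind
  rw [this]; ring

lemma mulSeq_cont {u v : ℕ → ℝ → ℝ} {k : ℕ} {s : Set ℝ}
    (hu : ∀ i ≤ k, ContinuousOn (u i) s) (hv : ∀ i ≤ k, ContinuousOn (v i) s) :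
    ContinuousOn (mulSeq u v k) s := by
  unfold mulSeq
  refine continuousOn_finsetSum _ (fun i hi => ?_)
  exact continuousOn_const.mul ((hu i (by grind)).mul (hv (k-i) (by grind)))

lemma mulSeq_bound {u v : ℕ → ℝ → ℝ} {k : ℕ} {y t P Q : ℝ} (ht : 0 < t)
    (hP : 0 ≤ P) (hQ : 0 ≤ Q)
    (hu : ∀ i ≤ k, |u i y| ≤ P * (t^i)⁻¹) (hv : ∀ i ≤ k, |v i y| ≤ Q * (t^i)⁻¹) :
    |mulSeq u v k y| ≤ 2^k * (P * Q) * (t^k)⁻¹ := by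
  unfold mulSeq
  refine (Finset.abs_sum_le_sum_abs _ _).trans ?_
  have : ∀ i ∈ Finset.range (k+1), |(k.choose i : ℝ) * (u i y * v (k - i) y)| ≤
      (k.choose i : ℝ) * (P * Q * (t^k)⁻¹) := by
    intro i hi
    have hik : i ≤ k := by grind
    rw [abs_mul, abs_mul, Nat.abs_cast]
    refine mul_le_mul_of_nonneg_left ?_ (by positivity)
    calc |u i y| * |v (k-i) y| ≤ (P * (t^i)⁻¹) * (Q * (t^(k-i))⁻¹) := by
          gcongr
          · exact hu i hik
          · exact hv (k-i) (by omega)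
      _ = P * Q * (t^i * t^(k-i))⁻¹ := by rw [mul_inv]; ring
      _ = _ := by rw [← pow_add, Nat.add_sub_cancel' hik]
  refine (Finset.sum_le_sum this).trans ?_
  rw [← Finset.sum_mul, ← Nat.cast_sum, Nat.sum_range_choose]
  push_cast
  apply le_of_eq; ring

/-- coefficients of derivatives of a power -/
noncomputable def pwc (lam : ℝ) (k : ℕ) : ℝ := ∏ i ∈ Finset.range k, (lam - i)

/-- derivatives of a power -/
noncomputable def pws (a lam : ℝ) (k : ℕ) (y : ℝ) : ℝ := pwc lam k * (y - a)^(lam - k)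

lemma pws_deriv (a lam : ℝ) (k : ℕ) {y : ℝ} (hy : a < y) :
    HasDerivAt (pws a lam k) (pws a lam (k+1) y) y := by
  have h1 : HasDerivAt (fun y => y - a) 1 y := (hasDerivAt_id y).sub_const a
  have h2 := (h1.rpow_const (p := lam - k) (Or.inl (by linarith : y - a ≠ 0))).const_mul (pwc lam k)
  refine HasDerivAt.congr_deriv (f := pws a lam k) h2 ?_
  rw [pws, pwc, pwc, Finset.prod_range_succ]
  push_cast
  rw [show lam - (k + 1) = lam - k - 1 by ring]
  ring

/-- derivatives of `1/(x-y)` in `y` -/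
noncomputable def invs (x : ℝ) (k : ℕ) (y : ℝ) : ℝ := (k.factorial : ℝ) * ((x - y)^(k+1))⁻¹

lemma invs_deriv {x : ℝ} (k : ℕ) {y : ℝ} (hy : y ≠ x) :
    HasDerivAt (invs x k) (invs x (k+1) y) y := by
  have h0 : x - y ≠ 0 := sub_ne_zero.mpr (Ne.symm hy)
  have h1 : HasDerivAt (fun y => x - y) (-1) y := by
    simpa using (hasDerivAt_id y).const_sub x
  have h2 := ((h1.fun_pow (k+1)).fun_inv (pow_ne_zero _ h0)).const_mul (k.factorial : ℝ)
  refine HasDerivAt.congr_deriv (f := invs x k) h2 ?_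
  rw [invs, Nat.factorial_succ]
  push_cast
  field_simp
  try ring

lemma invs_abs (x : ℝ) (k : ℕ) (y : ℝ) : |invs x k y| = (k.factorial : ℝ) * (|x - y|^(k+1))⁻¹ := by
  rw [invs, abs_mul, abs_inv, abs_pow, Nat.abs_cast]

lemma invs_cont (x : ℝ) (k : ℕ) {s : Set ℝ} (hs : x ∉ s) : ContinuousOn (invs x k) s := fun y hy =>
  (invs_deriv k (fun h : y = x => hs (by rw [← h]; exact hy))).continuousAt.continuousWithinAt

/-- derivative sequence of a function with an algebraic singularity at `a` -/
structure FS (L : ℕ) (a lam M : ℝ) (f : ℕ → ℝ → ℝ) : Prop where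
  der : ∀ k < L, ∀ y, a < y → HasDerivAt (f k) (f (k+1) y) y
  cont : ∀ k ≤ L, ContinuousOn (f k) (Ioi a)
  bd : ∀ k ≤ L, ∀ y ∈ Ioc a 1, |f k y| ≤ M * (y - a)^(lam - k)

lemma rpow_sub_nat {t : ℝ} (ht : 0 < t) (lam : ℝ) (k : ℕ) : t^(lam - k) = t^lam * (t^k)⁻¹ := by
  rw [Real.rpow_sub ht, Real.rpow_natCast, div_eq_mul_inv]

lemma FS_exists (L : ℕ) {a : ℝ} (ha : a ∈ Ioo (-1:ℝ) 1) (lam : ℝ) (z : ℝ → ℝ)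
    (hz : ContDiffOn ℝ (⊤ : ℕ∞) z (Icc (-1:ℝ) 1)) :
    ∃ M : ℝ, 0 < M ∧ ∃ f, FS L a lam M f ∧ ∀ y ∈ Ioc a 1, f 0 y = z y * (y - a)^lam := by
  obtain ⟨zs, h1, h2, h3⟩ := smooth_ext L z hz
  have hb : ∀ k ≤ L, ∃ B : ℝ, ∀ y ∈ Icc (-1:ℝ) 1, |zs k y| ≤ B := fun k hk => by
    obtain ⟨B, hB⟩ := isCompact_Icc.exists_bound_of_continuousOn (s := Icc (-1:ℝ) 1) (h2 k hk).continuousOn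
    exact ⟨B, hB⟩
  choose! B hB using hb
  set Bm : ℝ := ∑ k ∈ Finset.range (L+1), |B k| with hBm
  have hBm0 : 0 ≤ Bm := Finset.sum_nonneg (fun _ _ => abs_nonneg _)
  have hBk : ∀ k ≤ L, B k ≤ Bm := fun k hk => (le_abs_self _).trans
    (Finset.single_le_sum (f := fun k => |B k|) (fun _ _ => abs_nonneg _) (by grind))
  set Cm : ℝ := ∑ k ∈ Finset.range (L+1), |pwc lam k| with hCm
  have hCm0 : 0 ≤ Cm := Finset.sum_nonneg (fun _ _ => abs_nonneg _)
  have hCk : ∀ k ≤ L, |pwc lam k| ≤ Cm := fun k hk =>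
    (Finset.single_le_sum (f := fun k => |pwc lam k|) (fun _ _ => abs_nonneg _) (by grind))
  refine ⟨2^L * (Bm * 2^L * Cm) + 1, by positivity, mulSeq zs (pws a lam), ⟨?_, ?_, ?_⟩, ?_⟩
  · intro k hk y hy
    exact mulSeq_deriv (fun i hi => h1 i (by omega) y) (fun i _ => pws_deriv a lam i hy)
  · intro k hk
    exact mulSeq_cont (fun i hi => (h2 i (by omega)).continuousOn)
      (fun i _ y hy => (pws_deriv a lam i hy).continuousAt.continuousWithinAt)
  · intro k hk y hy
    have ht : 0 < y - a := by linarith [hy.1]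
    have ht2 : y - a ≤ 2 := by linarith [hy.2, ha.1]
    have hpos : 0 < (y-a)^lam := Real.rpow_pos_of_pos ht _
    have := mulSeq_bound (u := zs) (v := pws a lam) (k := k) (y := y) (P := Bm * 2^L)
      (Q := Cm * (y-a)^lam) ht (by positivity) (by positivity)
      (fun i hi => by
        have e1 := (hB i (by omega) y ⟨by linarith [hy.1, ha.1], hy.2⟩).trans (hBk i (by omega))
        refine e1.trans ?_
        rw [mul_assoc]
        refine le_mul_of_one_le_right hBm0 ?_
        rw [← div_eq_mul_inv, one_le_div (by positivity)]
        calc (y-a)^i ≤ 2^i := by gcongr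
          _ ≤ 2^L := pow_le_pow_right₀ (by norm_num) (by omega))
      (fun i hi => by
        rw [pws, rpow_sub_nat ht, abs_mul, abs_of_pos (show 0 < (y-a)^lam * ((y-a)^i)⁻¹ by positivity),
          ← mul_assoc]
        gcongr
        exact hCk i (by omega))
    refine this.trans ?_
    rw [rpow_sub_nat ht]
    calc 2^k * (Bm * 2^L * (Cm * (y-a)^lam)) * ((y-a)^k)⁻¹
        ≤ 2^L * (Bm * 2^L * (Cm * (y-a)^lam)) * ((y-a)^k)⁻¹ := by
          gcongr
          norm_num
      _ = (2^L * (Bm * 2^L * Cm)) * ((y-a)^lam * ((y-a)^k)⁻¹) := by ring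
      _ ≤ _ := by gcongr; linarith
  · intro y hy
    rw [mulSeq_zero, h3 y ⟨by linarith [hy.1, ha.1], hy.2⟩, pws, pwc]
    simp

end JacAux


namespace JacAux

section
variable {K : ℕ} {C d ν a : ℝ} {φ : ℕ → ℝ → ℝ}

/-- constant collecting the contributions of the elementary estimates -/
noncomputable def Cst (K : ℕ) (C d μ : ℝ) : ℝ :=
  C * (2 * (1 / (μ + 1) + 1)) + K * C + 2 * C * (Real.pi + (d^2)⁻¹)

lemma Cst_pos {μ : ℝ} (hμ : -1 < μ) (hC : 0 < C) (hd : 0 < d) : 0 < Cst K C d μ := by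
  have : 0 < μ + 1 := by linarith
  unfold Cst
  have := Real.pi_pos
  positivity

lemma inv_rpow_succ {μ : ℝ} (hν : 0 < ν) : (ν⁻¹)^(μ+1) = ν^(-μ-1) := by
  rw [Real.inv_rpow hν.le, ← Real.rpow_neg hν.le]; congr 1; ring

lemma one_sided (hφ : Ker K C d ν φ) (hK : 1 ≤ K) (hC : 0 < C) (hd : 0 < d) (ha : |a| ≤ 1 - 2 * d)
    (hν : 1 ≤ ν) (hνd : ν⁻¹ ≤ d) {μ M : ℝ} (hμ1 : -1 < μ) (hμ : μ + 2 ≤ K) (hM : 0 ≤ M)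
    {u : ℕ → ℝ → ℝ} (hu : ∀ k < K, ∀ y ∈ Ioc a 1, HasDerivAt (u k) (u (k+1) y) y)
    (huK : ContinuousOn (u K) (Ioc a 1))
    (hb : ∀ k ≤ K, ∀ y ∈ Ioc a 1, |u k y| ≤ M * (y - a)^(μ - k))
    (hintg : IntervalIntegrable (fun y => u 0 y * φ 0 y) volume a 1) :
    |∫ y in a..1, u 0 y * φ 0 y| ≤ M * Cst K C d μ * ν^(-μ - 1) := by
  have hν0 : 0 < ν := by linarith
  have ha' := abs_le.mp ha
  have hi0 : 0 < ν⁻¹ := by positivity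
  set b := a + ν⁻¹ with hbdef
  have hb1 : b ≤ 1 := by linarith
  have hsub : Icc b 1 ⊆ Ioc a 1 := fun y hy => ⟨by linarith [hy.1], hy.2⟩
  have i1 : IntervalIntegrable (fun y => u 0 y * φ 0 y) volume a b := hintg.mono_set (by
    rw [uIcc_of_le (by linarith), uIcc_of_le (by linarith)]; exact Icc_subset_Icc le_rfl hb1)
  have i2 : IntervalIntegrable (fun y => u 0 y * φ 0 y) volume b 1 := hintg.mono_set (by
    rw [uIcc_of_le (by linarith), uIcc_of_le (by linarith)]; exact Icc_subset_Icc (by linarith) le_rfl)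
  rw [← intervalIntegral.integral_add_adjacent_intervals i1 i2]
  have h1 := crude (a := a) hφ hC ha hμ1 hM hi0 hνd (p := a) (q := b) (by linarith) (by linarith)
    le_rfl (u := u 0) (fun y hy _ => by
      have := hb 0 (by omega) y ⟨hy.1, by linarith [hy.2]⟩
      refine this.trans ?_
      rw [abs_of_pos (by linarith [hy.1] : 0 < y - a)]
      simp only [Nat.cast_zero, sub_zero]
      gcongr
      have : 0 < (ν⁻¹)^μ := Real.rpow_pos_of_pos hi0 _
      linarith)
  rw [inv_rpow_succ hν0] at h1
  have h2 := ibp_est (a := a) hφ hK hC hd ha hν (p := b) (q := 1) (by linarith) hb1 le_rfl hμ hM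
    (fun k hk y hy => hu k hk y (hsub hy)) (huK.mono hsub) (fun y hy => by
      rw [abs_of_pos (by linarith [hy.1] : 0 < y - a), max_eq_left (by linarith [hy.1])]
      exact hb K le_rfl y (hsub hy))
  rw [Bd_one hφ, zero_sub, sub_neg_eq_add] at h2
  have h3 := Bd_est (μ := μ) (M := M) (y := b) (u := u) hφ hC hν hM (by
      rw [abs_le]; constructor <;> linarith) (fun k hk => by
      refine (hb k hk.le b ⟨by linarith, hb1⟩).trans (le_of_eq ?_)
      rw [hbdef, add_sub_cancel_left, Real.inv_rpow hν0.le, ← Real.rpow_neg hν0.le, neg_sub])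
  have h4 : ∀ x y w : ℝ, |x + y| ≤ |x| + |y + w| + |w| := fun x y w => by
    have := abs_add_le x y
    have h5 := abs_sub (y + w) w
    rw [add_sub_cancel_right] at h5
    linarith
  refine (h4 _ _ (Bd u φ K b)).trans ?_
  unfold Cst
  calc _ ≤ _ := add_le_add (add_le_add h1 h2) h3
    _ = _ := by ring

lemma invs_bound {x y h t : ℝ} {k : ℕ} (hk : k ≤ K) (hh : 0 < h) (ht : 0 < t) (h1 : h ≤ 2 * |x - y|)
    (h2 : t ≤ 2 * |x - y|) :
    |invs x k y| ≤ (K.factorial * 2^(K+1) : ℝ) * h⁻¹ * (t^k)⁻¹ := by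
  rw [invs_abs]
  have h3 : 0 < |x - y| := by linarith
  have h4 : h * t^k ≤ 2^(K+1) * |x-y|^(k+1) := by
    calc h * t^k ≤ (2 * |x-y|) * (2 * |x-y|)^k := by gcongr
      _ = 2^(k+1) * |x-y|^(k+1) := by ring
      _ ≤ _ := by gcongr; norm_num
  have h5 : (k.factorial : ℝ) ≤ K.factorial := by exact_mod_cast Nat.factorial_le hk
  have h6 : (|x-y|^(k+1))⁻¹ ≤ 2^(K+1) * (h * t^k)⁻¹ := by
    rw [← div_eq_mul_inv, le_div_iff₀ (by positivity), inv_mul_eq_div, div_le_iff₀ (by positivity)]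
    exact h4
  calc (k.factorial : ℝ) * (|x-y|^(k+1))⁻¹ ≤ K.factorial * (2^(K+1) * (h * t^k)⁻¹) := by gcongr
    _ = _ := by rw [mul_inv]; ring

/-- constant for products -/
noncomputable def CB (K : ℕ) : ℝ := 2^K * (K.factorial * 2^(K+1))

lemma CB_pos : 0 < CB K := by unfold CB; positivity

lemma B_bound {L : ℕ} {lam M x y h : ℝ} {f : ℕ → ℝ → ℝ} (hf : FS L a lam M f) (hM : 0 < M)
    (hKL : K ≤ L) {k : ℕ} (hk : k ≤ K) (hy : y ∈ Ioc a 1) (hh : 0 < h) (h1 : h ≤ 2 * |x - y|)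
    (h2 : y - a ≤ 2 * |x - y|) :
    |mulSeq f (invs x) k y| ≤ CB K * M * h⁻¹ * (y - a)^(lam - k) := by
  have ht : 0 < y - a := by linarith [hy.1]
  have hpos : 0 < (y-a)^lam := Real.rpow_pos_of_pos ht _
  have := mulSeq_bound (u := f) (v := invs x) (k := k) (y := y) (P := M * (y-a)^lam)
    (Q := (K.factorial * 2^(K+1) : ℝ) * h⁻¹) ht (by positivity) (by positivity)
    (fun i hi => by
      have := hf.bd i (by omega) y hy
      rwa [rpow_sub_nat ht, ← mul_assoc] at this)
    (fun i hi => invs_bound (by omega) hh ht h1 h2)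
  refine this.trans ?_
  rw [rpow_sub_nat ht, CB]
  calc (2:ℝ)^k * (M * (y-a)^lam * ((K.factorial * 2^(K+1) : ℝ) * h⁻¹)) * ((y-a)^k)⁻¹
      ≤ 2^K * (M * (y-a)^lam * ((K.factorial * 2^(K+1) : ℝ) * h⁻¹)) * ((y-a)^k)⁻¹ := by
        gcongr; norm_num
    _ = _ := by ring

lemma B_deriv {L : ℕ} {lam M x y : ℝ} {f : ℕ → ℝ → ℝ} (hf : FS L a lam M f) 
    {k : ℕ} (hk : k < L) (hy : a < y) (hyx : y ≠ x) :
    HasDerivAt (mulSeq f (invs x) k) (mulSeq f (invs x) (k+1) y) y :=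
  mulSeq_deriv (fun i hi => hf.der i (by omega) y hy) (fun i _ => invs_deriv i hyx)

lemma B_cont {L : ℕ} {lam M x : ℝ} {f : ℕ → ℝ → ℝ} (hf : FS L a lam M f) {s : Set ℝ}
    {k : ℕ} (hk : k ≤ L) (hs : s ⊆ Ioi a) (hx : x ∉ s) : ContinuousOn (mulSeq f (invs x) k) s :=
  mulSeq_cont (fun i hi => (hf.cont i (by omega)).mono hs) (fun i _ => invs_cont x i hx)

lemma ae_ne (c : ℝ) : ∀ᵐ x : ℝ ∂volume, x ≠ c := by simp [ae_iff, measure_singleton]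

/-- integrals of functions vanishing to the left of `a` -/
lemma int_right {g w : ℝ → ℝ} (ha1 : -1 ≤ a) (ha2 : a ≤ 1)
    (hI : IntervalIntegrable (fun y => g y * φ 0 y) volume (-1) 1)
    (h0 : ∀ y < a, g y = 0) (h1 : ∀ y ∈ Ioc a 1, g y = w y) :
    IntervalIntegrable (fun y => w y * φ 0 y) volume a 1 ∧
    ∫ y in (-1:ℝ)..1, g y * φ 0 y = ∫ y in a..1, w y * φ 0 y := by
  have i1 : IntervalIntegrable (fun y => g y * φ 0 y) volume (-1) a := hI.mono_set (by
    rw [uIcc_of_le (by linarith), uIcc_of_le (by linarith)]; exact Icc_subset_Icc le_rfl ha2)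
  have i2 : IntervalIntegrable (fun y => g y * φ 0 y) volume a 1 := hI.mono_set (by
    rw [uIcc_of_le (by linarith), uIcc_of_le (by linarith)]; exact Icc_subset_Icc (by linarith) le_rfl)
  refine ⟨i2.congr (fun y hy => ?_), ?_⟩
  · rw [uIoc_of_le ha2] at hy
    simp only [h1 y hy]
  · rw [← intervalIntegral.integral_add_adjacent_intervals i1 i2]
    have e1 : ∫ y in (-1:ℝ)..a, g y * φ 0 y = 0 := by
      refine intervalIntegral.integral_zero_ae ?_
      filter_upwards [ae_ne a] with y hya hy
      rw [uIoc_of_le ha1] at hy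
      rw [h0 y (lt_of_le_of_ne hy.2 hya), zero_mul]
    rw [e1, zero_add]
    refine intervalIntegral.integral_congr_ae (Filter.Eventually.of_forall (fun y hy => ?_))
    rw [uIoc_of_le ha2] at hy
    rw [h1 y hy]

/-- the case `x < a` -/
lemma case_left (hφ : Ker K C d ν φ) (hK : 1 ≤ K) (hC : 0 < C) (hd : 0 < d) (ha : |a| ≤ 1 - 2 * d)
    (hν : 1 ≤ ν) (hνd : ν⁻¹ ≤ d) {lam M : ℝ} (hμ1 : -1 < lam) (hμ : lam + 2 ≤ K) (hM : 0 < M)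
    {f : ℕ → ℝ → ℝ} {L : ℕ} (hKL : K ≤ L) (hf : FS L a lam M f) {F : ℝ → ℝ} (hF0 : ∀ y < a, F y = 0)
    (hF1 : ∀ y ∈ Ioc a 1, F y = f 0 y) {x : ℝ} (hx : x < a) :
    |∫ y in (-1:ℝ)..1, (F x - F y) / (x - y) * φ 0 y| ≤
      CB K * M * Cst K C d lam * |x - a|⁻¹ * ν^(-lam - 1) := by
  have ha' := abs_le.mp ha
  have hCs := Cst_pos (K := K) hμ1 hC hd
  have hCB : 0 < CB K := CB_pos
  have hν0 : 0 < ν := by linarith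
  by_cases hI : IntervalIntegrable (fun y => (F x - F y) / (x - y) * φ 0 y) volume (-1) 1
  swap
  · rw [intervalIntegral.integral_undef hI, abs_zero]; positivity
  obtain ⟨j1, j2⟩ := int_right (a := a) (φ := φ) (g := fun y => (F x - F y) / (x - y))
    (w := fun y => - mulSeq f (invs x) 0 y) (by linarith) (by linarith) hI
    (fun y hy => by simp only [hF0 x hx, hF0 y hy]; simp)
    (fun y hy => by
      simp only [hF0 x hx, hF1 y hy, mulSeq_zero, invs]
      simp [div_eq_mul_inv])
  rw [j2]
  simp only [neg_mul] at j1 ⊢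
  rw [intervalIntegral.integral_neg, abs_neg]
  have j1' : IntervalIntegrable (fun y => mulSeq f (invs x) 0 y * φ 0 y) volume a 1 := by
    exact j1.neg.congr (fun y _ => by simp)
  have hh : 0 < |x - a| := abs_pos.mpr (by linarith)
  have hxa : |x - a| = a - x := by rw [abs_of_neg (by linarith)]; ring
  have := one_sided (a := a) hφ hK hC hd ha hν hνd hμ1 hμ (M := CB K * M * |x-a|⁻¹) (by positivity)
    (u := mulSeq f (invs x)) (fun k hk y hy => B_deriv hf (by omega) hy.1 (by linarith [hy.1]))
    (B_cont hf hKL (fun y hy => hy.1) (fun h => by linarith [h.1]))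
    (fun k hk y hy => by
      have e : |x - y| = y - x := by rw [abs_of_neg (by linarith [hy.1])]; ring
      exact B_bound hf hM hKL hk hy hh (by rw [e, hxa]; linarith [hy.1]) (by rw [e]; linarith [hy.1])) j1'
  refine this.trans (le_of_eq ?_)
  ring

end
end JacAux


namespace JacAux

/-- derivatives of the difference quotient, in integral form -/
noncomputable def gs (f : ℕ → ℝ → ℝ) (x : ℝ) (k : ℕ) (y : ℝ) : ℝ :=
  ∫ s in (0:ℝ)..1, (1 - s)^k * f (k+1) (y + s * (x - y))

section
variable {L : ℕ} {a lam M x : ℝ} {f : ℕ → ℝ → ℝ}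

lemma seg_mem {lo hi y s : ℝ} (hy : y ∈ Icc lo hi) (hs : s ∈ Icc (0:ℝ) 1) :
    y + s * (x - y) ∈ Icc (min lo x) (max hi x) := by
  have h1 : min lo x ≤ lo := min_le_left _ _
  have h2 : min lo x ≤ x := min_le_right _ _
  have h3 : hi ≤ max hi x := le_max_left _ _
  have h4 : x ≤ max hi x := le_max_right _ _
  have e : y + s * (x - y) = (1 - s) * y + s * x := by ring
  rw [e]
  obtain ⟨s0, s1⟩ := hs
  obtain ⟨y0, y1⟩ := hy
  constructor
  · nlinarith [mul_nonneg (by linarith : 0 ≤ 1 - s) (by linarith : 0 ≤ y - min lo x),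
      mul_nonneg s0 (by linarith : 0 ≤ x - min lo x)]
  · nlinarith [mul_nonneg (by linarith : 0 ≤ 1 - s) (by linarith : 0 ≤ max hi x - y),
      mul_nonneg s0 (by linarith : 0 ≤ max hi x - x)]

lemma seg_gt {y s : ℝ} (hx : a < x) (hy : a < y) (hs : s ∈ Icc (0:ℝ) 1) : a < y + s * (x - y) :=
  lt_of_lt_of_le (lt_min hy hx) (seg_mem (lo := y) (hi := y) ⟨le_rfl, le_rfl⟩ hs).1

lemma gs_integrand_cont (hf : FS L a lam M f) (hx : a < x) {k : ℕ} (hk : k < L) {y : ℝ} (hy : a < y)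
    (j : ℕ) : ContinuousOn (fun s => (1 - s)^j * f (k+1) (y + s * (x - y))) (Icc (0:ℝ) 1) := by
  refine ContinuousOn.mul (by fun_prop) ?_
  exact (hf.cont (k+1) hk).comp (by fun_prop) (fun s hs => seg_gt hx hy hs)

lemma gs_deriv (hf : FS L a lam M f) (hx : a < x) {k : ℕ} (hk : k + 1 < L) {y : ℝ} (hy : a < y) :
    HasDerivAt (gs f x k) (gs f x (k+1) y) y := by
  set lo := (a + y) / 2 with hlo
  have hlo1 : a < lo := by linarith
  obtain ⟨B, hB⟩ := isCompact_Icc.exists_bound_of_continuousOn (s := Icc (min lo x) (max (y+1) x))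
    ((hf.cont (k+2) (by omega)).mono (fun w hw => lt_of_lt_of_le (lt_min hlo1 hx) hw.1))
  have hsub : uIoc (0:ℝ) 1 ⊆ Icc 0 1 := by rw [uIoc_of_le (by norm_num)]; exact Ioc_subset_Icc_self
  have meas : ∀ (j i : ℕ), i < L → ∀ w, a < w → AEStronglyMeasurable
      (fun s => (1 - s)^j * f (i+1) (w + s * (x - w))) (volume.restrict (uIoc (0:ℝ) 1)) :=
    fun j i hi w hw => ((gs_integrand_cont hf hx hi hw j).mono hsub).aestronglyMeasurable
      measurableSet_uIoc
  have := intervalIntegral.hasDerivAt_integral_of_dominated_loc_of_deriv_le (μ := volume)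
    (a := 0) (b := 1) (F := fun w s => (1 - s)^k * f (k+1) (w + s * (x - w)))
    (F' := fun w s => (1 - s)^(k+1) * f (k+1+1) (w + s * (x - w))) (x₀ := y) (s := Ioo lo (y+1))
    (bound := fun _ => B) (Ioo_mem_nhds (by linarith) (by linarith))
    (by
      filter_upwards [Ioi_mem_nhds hy] with w hw
      exact meas k k (by omega) w hw)
    (by
      refine ContinuousOn.intervalIntegrable ?_
      rw [uIcc_of_le (by norm_num)]
      exact gs_integrand_cont hf hx (by omega) hy k)
    (meas (k+1) (k+1) (by omega) y hy)
    (Filter.Eventually.of_forall (fun s hs w hw => by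
      have hs' := hsub hs
      have h1 := hB _ (seg_mem (x := x) ⟨hw.1.le, hw.2.le⟩ hs')
      rw [norm_mul]
      have h2 : ‖(1 - s)^(k+1)‖ ≤ 1 := by
        rw [norm_pow, Real.norm_eq_abs, abs_of_nonneg (by linarith [hs'.2])]
        exact pow_le_one₀ (by linarith [hs'.2]) (by linarith [hs'.1])
      calc _ ≤ 1 * B := mul_le_mul h2 h1 (norm_nonneg _) (by norm_num)
        _ = B := one_mul B))
    intervalIntegrable_const
    (Filter.Eventually.of_forall (fun s hs w hw => by
      have hs' := hsub hs
      have h1 := hf.der (k+1) hk _ (seg_gt hx (by linarith [hw.1] : a < w) hs')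
      have h2 : HasDerivAt (fun w => w + s * (x - w)) (1 - s) w := by
        have h3 := (hasDerivAt_id w).add (((hasDerivAt_id w).const_sub x).const_mul s)
        refine HasDerivAt.congr_deriv h3 ?_
        ring
      have h4 := (HasDerivAt.comp w h1 h2).const_mul ((1-s)^k)
      refine HasDerivAt.congr_deriv h4 ?_
      ring))
  exact this.2

lemma gs_zero (hf : FS L a lam M f) (hL : 0 < L) (hx : a < x) {y : ℝ} (hy : a < y) (hyx : y ≠ x) :
    gs f x 0 y = (f 0 x - f 0 y) / (x - y) := by
  have h0 : x - y ≠ 0 := sub_ne_zero.mpr hyx.symm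
  rw [eq_div_iff h0, gs, ← intervalIntegral.integral_mul_const]
  have hc := gs_integrand_cont hf hx hL hy 0
  have := intervalIntegral.integral_eq_sub_of_hasDerivAt (a := 0) (b := 1)
    (f := fun s => f 0 (y + s * (x - y)))
    (f' := fun s => (1 - s)^0 * f (0+1) (y + s * (x - y)) * (x - y))
    (fun s hs => by
      rw [uIcc_of_le (by norm_num)] at hs
      have h1 := hf.der 0 hL _ (seg_gt hx hy hs)
      have h2 : HasDerivAt (fun s => y + s * (x - y)) (x - y) s := by
        have := ((hasDerivAt_id s).mul_const (x - y)).const_add y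
        simpa using this
      have h4 := HasDerivAt.comp s h1 h2
      refine HasDerivAt.congr_deriv h4 ?_
      simp)
    (by
      refine ContinuousOn.intervalIntegrable ?_
      rw [uIcc_of_le (by norm_num)]
      exact hc.mul continuousOn_const)
  rw [this]
  simp

lemma gs_eq (hf : FS L a lam M f) (hx : a < x) : ∀ k < L, ∀ y ∈ Ioo a x,
    gs f x k y = f 0 x * invs x k y - mulSeq f (invs x) k y := by
  intro k
  induction k with
  | zero =>
    intro hk y hy
    rw [gs_zero hf hk hx hy.1 hy.2.ne, mulSeq_zero, invs]
    simp [div_eq_mul_inv, sub_mul]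
  | succ k ih =>
    intro hk y hy
    have h1 := gs_deriv hf hx hk hy.1
    have h2 := ((invs_deriv k hy.2.ne).const_mul (f 0 x)).sub
      (B_deriv hf (by omega : k < L) hy.1 hy.2.ne)
    refine h1.unique (h2.congr_of_eventuallyEq ?_)
    filter_upwards [Ioo_mem_nhds hy.1 hy.2] with w hw
    rw [ih (by omega) w hw]; rfl

/-- constant for the difference quotient -/
noncomputable def CG (lam : ℝ) : ℝ := 2 * (2^|lam| + 1 / (lam + 1))

lemma CG_pos (hl : -1 < lam) : 0 < CG lam := by
  have : 0 < lam + 1 := by linarith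
  unfold CG; positivity

lemma tau_bound {t h s : ℝ} (ht : 0 < t) (hh : 0 < h) (hth : h ≤ 2 * t) (hs : s ∈ Ioo (0:ℝ) 1) :
    ((1 - s) * t + s * h)^lam ≤ (2^|lam| + (1-s)^lam) * t^lam := by
  have s1 : 0 < 1 - s := by linarith [hs.2]
  have s0 := hs.1
  have hp1 : 0 < (1-s)^lam := Real.rpow_pos_of_pos s1 _
  have hp2 : 0 < t^lam := Real.rpow_pos_of_pos ht _
  have hp3 : (0:ℝ) < 2^|lam| := by positivity
  rcases le_total 0 lam with hl | hl
  · have h1 : (1 - s) * t + s * h ≤ 2 * t := by nlinarith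
    calc ((1 - s) * t + s * h)^lam ≤ (2*t)^lam := by gcongr
      _ = 2^|lam| * t^lam := by rw [Real.mul_rpow (by norm_num) ht.le, abs_of_nonneg hl]
      _ ≤ _ := by gcongr; linarith
  · have h1 : (1 - s) * t ≤ (1 - s) * t + s * h := by nlinarith
    calc ((1 - s) * t + s * h)^lam ≤ ((1-s)*t)^lam :=
          Real.rpow_le_rpow_of_nonpos (by positivity) h1 hl
      _ = (1-s)^lam * t^lam := by rw [Real.mul_rpow s1.le ht.le]
      _ ≤ _ := by gcongr; linarith

lemma gs_bound (hf : FS L a lam M f) (hM : 0 < M) (hl : -1 < lam) (hx : x ∈ Ioc a 1) {k : ℕ} (hk : k < L)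
    {y : ℝ} (hy : y ∈ Ioc a 1) (hxy : x - a ≤ 2 * (y - a)) :
    |gs f x k y| ≤ CG lam * M * (x - a)⁻¹ * (y - a)^(lam - k) := by
  set t := y - a with ht'
  set h := x - a with hh'
  have ht : 0 < t := by linarith [hy.1]
  have hh : 0 < h := by linarith [hx.1]
  have hl1 : 0 < lam + 1 := by linarith
  have i1 : IntervalIntegrable (fun s : ℝ => (1-s)^lam) volume 0 1 := by
    have := (intervalIntegral.intervalIntegrable_rpow' (a := 0) (b := 1) hl).comp_sub_left 1
    simpa using this.symm
  have e1 : ∫ s in (0:ℝ)..1, (1-s)^lam = 1 / (lam + 1) := by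
    rw [intervalIntegral.integral_comp_sub_left (fun s : ℝ => s^lam) 1, integral_rpow (Or.inl hl)]
    simp [Real.zero_rpow hl1.ne']
  set D := M * (2 * h⁻¹) * (t^lam * (t^k)⁻¹) with hD
  have := intervalIntegral.norm_integral_le_of_norm_le (μ := volume) (a := 0) (b := 1) (by norm_num)
    (f := fun s => (1 - s)^k * f (k+1) (y + s * (x - y)))
    (g := fun s => D * (2^|lam| + (1-s)^lam)) (by
      filter_upwards [ae_ne 1] with s hs1 hs
      have hs' : s ∈ Ioo (0:ℝ) 1 := ⟨hs.1, lt_of_le_of_ne hs.2 hs1⟩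
      have s1 : 0 < 1 - s := by linarith [hs'.2]
      have s0 := hs.1
      set w := y + s * (x - y) with hw'
      have hw : w ∈ Ioc a 1 := by
        refine ⟨seg_gt hx.1 hy.1 ⟨hs.1.le, hs.2⟩, ?_⟩
        nlinarith [hx.2, hy.2]
      have hτ : w - a = (1-s)*t + s*h := by rw [hw', ht', hh']; ring
      set τ := (1-s)*t + s*h with hτ'
      have hτ0 : 0 < τ := by positivity
      have b1 := hf.bd (k+1) (by omega) w hw
      rw [hτ, rpow_sub_nat hτ0] at b1
      have b2 := tau_bound (lam := lam) ht hh hxy hs'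
      have b3 : (1-s)^k * (τ^k)⁻¹ ≤ (t^k)⁻¹ := by
        rw [← div_eq_mul_inv, div_le_iff₀ (by positivity), inv_mul_eq_div, le_div_iff₀ (by positivity),
          ← mul_pow]
        gcongr
        nlinarith
      have b4 : τ⁻¹ ≤ 2 * h⁻¹ := by
        rw [← div_eq_mul_inv, le_div_iff₀ hh, inv_mul_eq_div, div_le_iff₀ hτ0]
        nlinarith
      have hτl : 0 < τ^lam := Real.rpow_pos_of_pos hτ0 _
      rw [Real.norm_eq_abs, abs_mul, abs_of_pos (show 0 < (1-s)^k by positivity)]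
      calc (1-s)^k * |f (k+1) w| ≤ (1-s)^k * (M * (τ^lam * (τ^(k+1))⁻¹)) := by gcongr
        _ = M * τ⁻¹ * (τ^lam * ((1-s)^k * (τ^k)⁻¹)) := by rw [pow_succ, mul_inv]; ring
        _ ≤ M * (2 * h⁻¹) * (((2^|lam| + (1-s)^lam) * t^lam) * (t^k)⁻¹) := by gcongr
        _ = D * (2^|lam| + (1-s)^lam) := by rw [hD]; ring)
    ((intervalIntegrable_const.add i1).const_mul _)
  rw [intervalIntegral.integral_const_mul, intervalIntegral.integral_add intervalIntegrable_const i1, e1,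
    intervalIntegral.integral_const, Real.norm_eq_abs] at this
  refine this.trans (le_of_eq ?_)
  rw [hD, rpow_sub_nat ht, CG]
  simp
  ring

end
end JacAux


namespace JacAux

section
variable {K L : ℕ} {C d ν a lam M x : ℝ} {φ f : ℕ → ℝ → ℝ}

/-- constant for the elementary part -/
noncomputable def CA (K : ℕ) (lam : ℝ) : ℝ := (K.factorial * 2^(K+1)) * 4^|lam|

lemma CA_ge : 2 ≤ CA K lam := by
  have h1 : (1:ℝ) ≤ K.factorial := by exact_mod_cast Nat.one_le_iff_ne_zero.mpr (Nat.factorial_ne_zero K)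
  have h2 : (1:ℝ) ≤ 4^|lam| := Real.one_le_rpow (by norm_num) (abs_nonneg _)
  have h3 : (1:ℝ) ≤ 2^K := one_le_pow₀ (by norm_num)
  have h4 : (2:ℝ) ≤ K.factorial * 2^(K+1) := by rw [pow_succ]; nlinarith
  unfold CA
  nlinarith

/-- derivatives of `f x / (x - y)` -/
noncomputable def As (f : ℕ → ℝ → ℝ) (x : ℝ) (k : ℕ) (y : ℝ) : ℝ := f 0 x * invs x k y

lemma fx_bound (hf : FS L a lam M f) (hx : x ∈ Ioc a 1) : |f 0 x| ≤ M * (x - a)^lam := by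
  simpa using hf.bd 0 (by omega) x hx

lemma A_bound (hf : FS L a lam M f) (hM : 0 < M) (hl : -1 < lam) (hx : x ∈ Ioc a 1) {k : ℕ}
    (hk : k ≤ K) {y m : ℝ} (hm : 0 < m) (h1 : x - a ≤ 2 * |x - y|) (h2 : m ≤ 2 * |x - y|)
    (h3 : lam ≤ k ∨ x - a ≤ 4 * m) :
    |As f x k y| ≤ CA K lam * M * (x - a)⁻¹ * m^(lam - k) := by
  have hh : 0 < x - a := by linarith [hx.1]
  have hfx := fx_bound hf hx
  rw [As, abs_mul, invs_abs]
  set h := x - a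
  set r := |x - y|
  have hr : 0 < r := by linarith
  have h5 : (k.factorial : ℝ) ≤ K.factorial := by exact_mod_cast Nat.factorial_le hk
  have h4p : (1:ℝ) ≤ 4^|lam| := Real.one_le_rpow (by norm_num) (abs_nonneg _)
  have key : h^lam * h ≤ 4^|lam| * (2*r)^(k+1) * m^(lam - k) := by
    rcases h3 with h3 | h3
    · have e1 : h^(lam+1) ≤ (2*r)^(lam+1) := Real.rpow_le_rpow hh.le h1 (by linarith)
      have e2 : (2*r)^(lam - k) ≤ m^(lam - k) :=
        Real.rpow_le_rpow_of_nonpos hm h2 (by linarith)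
      have e3 : (2*r)^(lam+1) = (2*r)^(k+1) * (2*r)^(lam - k) := by
        rw [← Real.rpow_natCast, ← Real.rpow_add (by positivity)]
        congr 1; push_cast; ring
      have e4 : h^lam * h = h^(lam+1) := by rw [Real.rpow_add_one hh.ne']
      have hmp : 0 < m^(lam - k) := Real.rpow_pos_of_pos hm _
      calc h^lam * h ≤ (2*r)^(k+1) * m^(lam - k) := by
            rw [e4]; refine e1.trans ?_; rw [e3]; gcongr
        _ = 1 * ((2*r)^(k+1) * m^(lam - k)) := (one_mul _).symm
        _ ≤ 4^|lam| * ((2*r)^(k+1) * m^(lam - k)) := by gcongr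
        _ = _ := by ring
    · rcases le_total lam k with hlk | hlk
      · have e1 : h^(lam+1) ≤ (2*r)^(lam+1) := Real.rpow_le_rpow hh.le h1 (by linarith)
        have e2 : (2*r)^(lam - k) ≤ m^(lam - k) :=
          Real.rpow_le_rpow_of_nonpos hm h2 (by linarith)
        have e3 : (2*r)^(lam+1) = (2*r)^(k+1) * (2*r)^(lam - k) := by
          rw [← Real.rpow_natCast, ← Real.rpow_add (by positivity)]
          congr 1; push_cast; ring
        have e4 : h^lam * h = h^(lam+1) := by rw [Real.rpow_add_one hh.ne']
        have hmp : 0 < m^(lam - k) := Real.rpow_pos_of_pos hm _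
        calc h^lam * h ≤ (2*r)^(k+1) * m^(lam - k) := by
              rw [e4]; refine e1.trans ?_; rw [e3]; gcongr
          _ = 1 * ((2*r)^(k+1) * m^(lam - k)) := (one_mul _).symm
          _ ≤ 4^|lam| * ((2*r)^(k+1) * m^(lam - k)) := by gcongr
          _ = _ := by ring
      · have hl0 : 0 ≤ lam := le_trans (by positivity) hlk
        have e1 : h^(lam - k) ≤ (4*m)^(lam - k) := Real.rpow_le_rpow hh.le h3 (by linarith)
        have e2 : (4*m)^(lam - k) ≤ 4^|lam| * m^(lam - k) := by
          rw [Real.mul_rpow (by norm_num) hm.le]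
          have hmp : 0 < m^(lam - k) := Real.rpow_pos_of_pos hm _
          gcongr
          · norm_num
          · rw [abs_of_nonneg hl0]; have : (0:ℝ) ≤ k := by positivity
            linarith
        have e3 : h^lam * h = h^(k+1) * h^(lam - k) := by
          rw [← Real.rpow_natCast, ← Real.rpow_add hh, ← Real.rpow_add_one hh.ne']
          congr 1; push_cast; ring
        rw [e3]
        calc h^(k+1) * h^(lam - k) ≤ (2*r)^(k+1) * (4^|lam| * m^(lam - k)) := by
              gcongr; exact e1.trans e2
          _ = _ := by ring
  have key2 : h^lam * (r^(k+1))⁻¹ ≤ (2^(K+1) * 4^|lam|) * h⁻¹ * m^(lam - k) := by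
    have hmp : 0 < m^(lam - k) := Real.rpow_pos_of_pos hm _
    have h2k : (2:ℝ)^(k+1) ≤ 2^(K+1) := pow_le_pow_right₀ (by norm_num) (by omega)
    have : h^lam ≤ (2^(k+1) * 4^|lam|) * h⁻¹ * m^(lam - k) * r^(k+1) := by
      have : h^lam = h^lam * h * h⁻¹ := by field_simp
      rw [this]
      calc h^lam * h * h⁻¹ ≤ (4^|lam| * (2*r)^(k+1) * m^(lam - k)) * h⁻¹ := by gcongr
        _ = _ := by rw [mul_pow]; ring
    rw [← div_eq_mul_inv, div_le_iff₀ (by positivity)]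
    refine this.trans ?_
    gcongr
  have hhl : 0 < h^lam := Real.rpow_pos_of_pos hh _
  calc |f 0 x| * (k.factorial * (r^(k+1))⁻¹) ≤ (M * h^lam) * (K.factorial * (r^(k+1))⁻¹) := by gcongr
    _ = M * K.factorial * (h^lam * (r^(k+1))⁻¹) := by ring
    _ ≤ M * K.factorial * ((2^(K+1) * 4^|lam|) * h⁻¹ * m^(lam - k)) := by gcongr
    _ = _ := by rw [CA]; ring

lemma A_deriv {k : ℕ} {y : ℝ} (hyx : y ≠ x) : HasDerivAt (As f x k) (As f x (k+1) y) y :=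
  (invs_deriv k hyx).const_mul (f 0 x)

lemma A_cont {k : ℕ} {s : Set ℝ} (hs : x ∉ s) : ContinuousOn (As f x k) s :=
  continuousOn_const.mul (invs_cont x k hs)

lemma sub_int {g : ℝ → ℝ} (hI : IntervalIntegrable g volume (-1) 1) {p q : ℝ} (hp : -1 ≤ p)
    (hpq : p ≤ q) (hq : q ≤ 1) : IntervalIntegrable g volume p q := hI.mono_set (by
    rw [uIcc_of_le hpq, uIcc_of_le (by linarith)]; exact Icc_subset_Icc hp hq)

/-- the case `x > a`, away from `a` -/
lemma case_far (hφ : Ker K C d ν φ) (hK : 1 ≤ K) (hC : 0 < C) (hd : 0 < d) (ha : |a| ≤ 1 - 2 * d)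
    (hν : 1 ≤ ν) (hνd : 4 * ν⁻¹ ≤ d) (hμ1 : -1 < lam) (hμ : lam + 2 ≤ K) (hM : 0 < M)
    (hKL : K + 2 ≤ L) (hf : FS L a lam M f) {F : ℝ → ℝ} (hF0 : ∀ y < a, F y = 0)
    (hF1 : ∀ y ∈ Ioc a 1, F y = f 0 y) (hx : x ∈ Ioc a 1) (hfar : 4 * ν⁻¹ ≤ x - a)
    (hI : IntervalIntegrable (fun y => (F x - F y) / (x - y) * φ 0 y) volume (-1) 1) :
    |∫ y in (-1:ℝ)..1, (F x - F y) / (x - y) * φ 0 y| ≤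
      M * (x - a)⁻¹ * (CA K lam * (2 * C * (Real.pi + (d^2)⁻¹)) + CB K * Cst K C d lam
        + CG lam * (2 * C * (Real.pi + (d^2)⁻¹))) * ν^(-lam - 1) := by
  have hν0 : 0 < ν := by linarith
  have ha' := abs_le.mp ha
  have hi0 : 0 < ν⁻¹ := by positivity
  have hCA : 0 < CA K lam := by linarith [CA_ge (K := K) (lam := lam)]
  have hCB : 0 < CB K := CB_pos
  have hCG := CG_pos hμ1
  have hh : 0 < x - a := by linarith [hx.1]
  have hx1 := hx.2
  have hKl : lam ≤ K := by linarith
  set c := a + (x - a) / 2 with hc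
  set b := a + ν⁻¹ with hb
  set g : ℝ → ℝ := fun y => (F x - F y) / (x - y) * φ 0 y with hg
  have hcx : c < x := by linarith
  have hbc : b ≤ c := by linarith
  have hab : a ≤ b := by linarith
  -- part A
  have dA := ibp_est (a := a) hφ hK hC hd ha hν (p := -1) (q := c) le_rfl (by linarith) (by linarith) hμ
    (M := CA K lam * M * (x-a)⁻¹) (by positivity) (u := As f x)
    (fun k hk y hy => A_deriv (by linarith [hy.2])) (A_cont (fun h => by linarith [h.2]))
    (fun y hy => by
      have e : |x - y| = x - y := abs_of_pos (by linarith [hy.2])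
      refine A_bound hf hM hμ1 hx le_rfl (lt_of_lt_of_le hi0 (le_max_right _ _)) ?_ ?_ (Or.inl hKl)
      · rw [e]; linarith [hy.2]
      · rw [e]
        refine max_le (abs_le.mpr ⟨?_, ?_⟩) ?_ <;> linarith [hy.2])
  rw [Bd_neg_one hφ, sub_zero] at dA
  -- part B
  have bB : ∀ k ≤ K, ∀ y ∈ Ioc a c, |mulSeq f (invs x) k y| ≤
      CB K * M * (x-a)⁻¹ * (y-a)^(lam - k) := fun k hk y hy => by
    have e : |x - y| = x - y := abs_of_pos (by linarith [hy.2])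
    exact B_bound hf hM (by omega) hk ⟨hy.1, by linarith [hy.2]⟩ hh (by rw [e]; linarith [hy.2])
      (by rw [e]; linarith [hy.2])
  have dB := ibp_est (a := a) hφ hK hC hd ha hν (p := b) (q := c) (by linarith) hbc (by linarith) hμ
    (M := CB K * M * (x-a)⁻¹) (by positivity) (u := mulSeq f (invs x))
    (fun k hk y hy => B_deriv hf (by omega) (by linarith [hy.1]) (by linarith [hy.2]))
    (B_cont hf (by omega) (fun y hy => by
      have := hy.1
      simp only [mem_Ioi]; linarith) (fun h => by linarith [h.2]))
    (fun y hy => by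
      rw [abs_of_pos (by linarith [hy.1] : 0 < y - a), max_eq_left (by linarith [hy.1])]
      exact bB K le_rfl y ⟨by linarith [hy.1], hy.2⟩)
  have dBb := Bd_est (μ := lam) (M := CB K * M * (x-a)⁻¹) (y := b) (u := mulSeq f (invs x)) hφ hC hν
    (by positivity) (by rw [abs_le]; constructor <;> linarith) (fun k hk => by
      refine (bB k hk.le b ⟨by linarith, hbc⟩).trans (le_of_eq ?_)
      rw [hb, add_sub_cancel_left, Real.inv_rpow hν0.le, ← Real.rpow_neg hν0.le, neg_sub])
  have dBa := crude (a := a) hφ hC ha hμ1 (M := CB K * M * (x-a)⁻¹) (by positivity) hi0 (by linarith)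
    (p := a) (q := b) (by linarith) hab
    le_rfl (u := mulSeq f (invs x) 0) (fun y hy _ => by
      have := bB 0 (by omega) y ⟨hy.1, by linarith [hy.2]⟩
      refine this.trans ?_
      rw [abs_of_pos (by linarith [hy.1] : 0 < y - a)]
      simp only [Nat.cast_zero, sub_zero]
      gcongr
      have : 0 < (ν⁻¹)^lam := Real.rpow_pos_of_pos hi0 _
      linarith)
  rw [inv_rpow_succ hν0] at dBa
  -- part G
  have dG := ibp_est (a := a) hφ hK hC hd ha hν (p := c) (q := 1) (by linarith) (by linarith) le_rfl hμ
    (M := CG lam * M * (x-a)⁻¹) (by positivity) (u := gs f x)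
    (fun k hk y hy => gs_deriv hf hx.1 (by omega) (by linarith [hy.1]))
    (fun y hy => (gs_deriv hf hx.1 (by omega) (by linarith [hy.1])).continuousAt.continuousWithinAt)
    (fun y hy => by
      rw [abs_of_pos (by linarith [hy.1] : 0 < y - a), max_eq_left (by linarith [hy.1])]
      exact gs_bound hf hM hμ1 hx (by omega) ⟨by linarith [hy.1], hy.2⟩ (by linarith [hy.1]))
  rw [Bd_one hφ, zero_sub, sub_neg_eq_add] at dG
  -- cancellation at `c`
  have hcan : Bd (gs f x) φ K c = Bd (As f x) φ K c - Bd (mulSeq f (invs x)) φ K c := by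
    unfold Bd
    rw [← Finset.sum_sub_distrib]
    refine Finset.sum_congr rfl (fun k hk => ?_)
    rw [gs_eq hf hx.1 k (by have := Finset.mem_range.mp hk; omega) c ⟨by linarith, hcx⟩, As]
    ring
  -- splitting of the integral
  have iA : IntervalIntegrable (fun y => As f x 0 y * φ 0 y) volume (-1) c := by
    refine (hφ.int le_rfl (by linarith) (by linarith) (by omega)).continuousOn_mul ?_
    rw [uIcc_of_le (by linarith)]
    exact A_cont (fun h => by linarith [h.2])
  have ig1 : IntervalIntegrable g volume (-1) c := sub_int hI le_rfl (by linarith) (by linarith)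
  have ig2 : IntervalIntegrable g volume c 1 := sub_int hI (by linarith) (by linarith) le_rfl
  have iW : IntervalIntegrable (fun y => As f x 0 y * φ 0 y - g y) volume (-1) c := iA.sub ig1
  have iW1 : IntervalIntegrable (fun y => As f x 0 y * φ 0 y - g y) volume (-1) a := iW.mono_set (by
    rw [uIcc_of_le (by linarith), uIcc_of_le (by linarith)]; exact Icc_subset_Icc le_rfl (by linarith))
  have iW2 : IntervalIntegrable (fun y => As f x 0 y * φ 0 y - g y) volume a b := iW.mono_set (by
    rw [uIcc_of_le (by linarith), uIcc_of_le (by linarith)]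
    exact Icc_subset_Icc (by linarith) (by linarith))
  have iW3 : IntervalIntegrable (fun y => As f x 0 y * φ 0 y - g y) volume b c := iW.mono_set (by
    rw [uIcc_of_le (by linarith), uIcc_of_le (by linarith)]
    exact Icc_subset_Icc (by linarith) (by linarith))
  have eB : ∀ y ∈ Ioc a c, As f x 0 y * φ 0 y - g y = mulSeq f (invs x) 0 y * φ 0 y := by
    intro y hy
    have hxy : x - y ≠ 0 := by linarith [hy.2]
    simp only [hg]
    rw [hF1 x hx, hF1 y ⟨hy.1, by linarith [hy.2]⟩, As, mulSeq_zero, invs]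
    simp
    field_simp
    ring
  have sW1 : ∫ y in (-1:ℝ)..a, (As f x 0 y * φ 0 y - g y) = 0 := by
    refine intervalIntegral.integral_zero_ae ?_
    filter_upwards [ae_ne a] with y hya hy
    rw [uIoc_of_le (by linarith)] at hy
    have hya' : y < a := lt_of_le_of_ne hy.2 hya
    have hxy : x - y ≠ 0 := by linarith
    simp only [hg]
    rw [hF1 x hx, hF0 y hya', As, invs]
    simp
    field_simp
    ring
  have sW2 : ∫ y in a..b, (As f x 0 y * φ 0 y - g y) = ∫ y in a..b, mulSeq f (invs x) 0 y * φ 0 y := by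
    refine intervalIntegral.integral_congr_ae (Filter.Eventually.of_forall (fun y hy => ?_))
    rw [uIoc_of_le hab] at hy
    exact eB y ⟨hy.1, by linarith [hy.2]⟩
  have sW3 : ∫ y in b..c, (As f x 0 y * φ 0 y - g y) = ∫ y in b..c, mulSeq f (invs x) 0 y * φ 0 y := by
    refine intervalIntegral.integral_congr_ae (Filter.Eventually.of_forall (fun y hy => ?_))
    rw [uIoc_of_le hbc] at hy
    exact eB y ⟨by linarith [hy.1], hy.2⟩
  have sG : ∫ y in c..1, g y = ∫ y in c..1, gs f x 0 y * φ 0 y := by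
    refine intervalIntegral.integral_congr_ae ?_
    filter_upwards [ae_ne x] with y hyx hy
    rw [uIoc_of_le (by linarith)] at hy
    simp only [hg]
    rw [gs_zero hf (by omega) hx.1 (by linarith [hy.1]) hyx, hF1 x hx, hF1 y ⟨by linarith [hy.1], hy.2⟩]
  have s1 : ∫ y in (-1:ℝ)..c, (As f x 0 y * φ 0 y - g y) =
      (∫ y in (-1:ℝ)..c, As f x 0 y * φ 0 y) - ∫ y in (-1:ℝ)..c, g y :=
    intervalIntegral.integral_sub iA ig1
  rw [← intervalIntegral.integral_add_adjacent_intervals (iW1.trans iW2) iW3,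
    ← intervalIntegral.integral_add_adjacent_intervals iW1 iW2, sW1, sW2, sW3] at s1
  have s2 := intervalIntegral.integral_add_adjacent_intervals ig1 ig2
  rw [sG] at s2
  change |∫ y in (-1:ℝ)..1, g y| ≤ _
  rw [← s2]
  have s3 : (∫ y in (-1:ℝ)..c, g y) + ∫ y in c..1, gs f x 0 y * φ 0 y =
      ((∫ y in (-1:ℝ)..c, As f x 0 y * φ 0 y) - Bd (As f x) φ K c)
      - (∫ y in a..b, mulSeq f (invs x) 0 y * φ 0 y)
      - ((∫ y in b..c, mulSeq f (invs x) 0 y * φ 0 y)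
          - (Bd (mulSeq f (invs x)) φ K c - Bd (mulSeq f (invs x)) φ K b))
      + Bd (mulSeq f (invs x)) φ K b
      + ((∫ y in c..1, gs f x 0 y * φ 0 y) + Bd (gs f x) φ K c) := by
    rw [hcan]; linarith
  rw [s3]
  have tri : ∀ p q r s t : ℝ, |p - q - r + s + t| ≤ |p| + |q| + |r| + |s| + |t| := fun p q r s t => by
    have := abs_add_le (p - q - r + s) t
    have := abs_add_le (p - q - r) s
    have := abs_sub (p - q) r
    have := abs_sub p q
    linarith
  refine (tri _ _ _ _ _).trans ?_
  calc _ ≤ _ := add_le_add (add_le_add (add_le_add (add_le_add dA dBa) dB) dBb) dG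
    _ = _ := by unfold Cst; ring

end
end JacAux


namespace JacAux

section
variable {K L : ℕ} {C d ν a lam M x : ℝ} {φ f : ℕ → ℝ → ℝ}

/-- pointwise bound of the difference quotient near the singularity -/
lemma g_near (hK : 1 ≤ K) (hμ1 : -1 < lam) (hM : 0 < M)
    (hKL : K + 2 ≤ L) (hf : FS L a lam M f) {F : ℝ → ℝ} (hF0 : ∀ y < a, F y = 0)
    (hF1 : ∀ y ∈ Ioc a 1, F y = f 0 y) (hx : x ∈ Ioc a 1) {s : ℝ} (hs : x - a ≤ s) {y : ℝ}
    (hy : y ≤ 1) (hya : y ≠ a) :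
    |(F x - F y) / (x - y)| ≤ (CA K lam + CB K + CG lam) * M * (x - a)⁻¹ * (|y - a|^lam + s^lam) := by
  have hCA : 0 < CA K lam := by linarith [CA_ge (K := K) (lam := lam)]
  have hCA2 := CA_ge (K := K) (lam := lam)
  have hCB : 0 < CB K := CB_pos
  have hCG := CG_pos hμ1
  have hh : 0 < x - a := by linarith [hx.1]
  have hs0 : 0 < s := by linarith
  have ht : 0 < |y - a| := abs_pos.mpr (sub_ne_zero.mpr hya)
  have p1 : 0 < |y - a|^lam := Real.rpow_pos_of_pos ht _
  have p2 : 0 < s^lam := Real.rpow_pos_of_pos hs0 _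
  have hA : x - a ≤ 2 * |x - y| → |y - a| ≤ 2 * |x - y| →
      |As f x 0 y| ≤ CA K lam * M * (x-a)⁻¹ * (|y - a|^lam + s^lam) := by
    intro h1 h2
    rcases le_total lam 0 with hl | hl
    · have := A_bound (K := K) (k := 0) hf hM hμ1 hx (by omega) ht h1 h2 (Or.inl (by simpa using hl))
      simp only [Nat.cast_zero, sub_zero] at this
      refine this.trans ?_
      gcongr; linarith
    · have hxy : 0 < |x - y| := by linarith
      have e1 : |invs x 0 y| ≤ 2 * (x-a)⁻¹ := by
        rw [invs_abs]; simp
        rw [← div_eq_mul_inv, le_div_iff₀ hh, inv_mul_eq_div, div_le_iff₀ hxy]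
        exact h1
      have e2 := fx_bound hf hx
      have e3 : (x-a)^lam ≤ s^lam := Real.rpow_le_rpow hh.le hs hl
      rw [As, abs_mul]
      calc |f 0 x| * |invs x 0 y| ≤ (M * s^lam) * (2 * (x-a)⁻¹) := by
            gcongr; exact e2.trans (by gcongr)
        _ = 2 * M * (x-a)⁻¹ * s^lam := by ring
        _ ≤ _ := by gcongr; linarith
  have base : 0 ≤ M * (x-a)⁻¹ * (|y - a|^lam + s^lam) := by positivity
  rcases lt_or_gt_of_ne hya with h | h
  · have e : |x - y| = x - y := abs_of_pos (by linarith)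
    have := hA (by rw [e]; linarith) (by rw [e, abs_of_neg (by linarith)]; linarith)
    have e2 : (F x - F y) / (x - y) = As f x 0 y := by
      rw [hF1 x hx, hF0 y h, As, invs]; simp [div_eq_mul_inv]
    rw [e2]
    refine this.trans ?_
    gcongr; linarith
  · have hy' : y ∈ Ioc a 1 := ⟨h, hy⟩
    have et : |y - a| = y - a := abs_of_pos (by linarith)
    rcases le_total (y - a) ((x - a)/2) with h2 | h2
    · have e : |x - y| = x - y := abs_of_pos (by linarith)
      have h1 := hA (by rw [e]; linarith) (by rw [e, et]; linarith)
      have h3 := B_bound (K := K) (k := 0) (x := x) hf hM (by omega) (by omega) hy' hh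
        (by rw [e]; linarith) (by rw [e]; linarith)
      simp only [Nat.cast_zero, sub_zero] at h3
      rw [← et] at h3
      have e2 : (F x - F y) / (x - y) = As f x 0 y - mulSeq f (invs x) 0 y := by
        rw [hF1 x hx, hF1 y hy', As, mulSeq_zero, invs]; simp [div_eq_mul_inv, sub_mul]
      rw [e2]
      refine (abs_sub _ _).trans ((add_le_add h1 h3).trans ?_)
      have h4 : CB K * M * (x-a)⁻¹ * |y-a|^lam ≤ CB K * M * (x-a)⁻¹ * (|y-a|^lam + s^lam) := by
        gcongr; linarith
      nlinarith [mul_nonneg hCG.le base]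
    · by_cases hyx : y = x
      · rw [hyx, sub_self, zero_div, abs_zero]; rw [hyx] at base
        have : 0 ≤ (CA K lam + CB K + CG lam) * (M * (x-a)⁻¹ * (|x - a|^lam + s^lam)) :=
          mul_nonneg (by linarith) base
        linarith
      · have h3 := gs_bound (k := 0) hf hM hμ1 hx (by omega) hy' (by linarith)
        simp only [Nat.cast_zero, sub_zero] at h3
        rw [gs_zero hf (by omega) hx.1 h hyx, ← et] at h3
        rw [hF1 x hx, hF1 y hy']
        refine h3.trans ?_
        calc CG lam * M * (x-a)⁻¹ * |y-a|^lam ≤ CG lam * M * (x-a)⁻¹ * (|y-a|^lam + s^lam) := by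
              gcongr; linarith
          _ ≤ _ := by gcongr; linarith

/-- the case `x > a`, near `a` -/
lemma case_near (hφ : Ker K C d ν φ) (hK : 1 ≤ K) (hC : 0 < C) (hd : 0 < d) (ha : |a| ≤ 1 - 2 * d)
    (hν : 1 ≤ ν) (hνd : 4 * ν⁻¹ ≤ d) (hμ1 : -1 < lam) (hμ : lam + 2 ≤ K) (hM : 0 < M)
    (hKL : K + 2 ≤ L) (hf : FS L a lam M f) {F : ℝ → ℝ} (hF0 : ∀ y < a, F y = 0)
    (hF1 : ∀ y ∈ Ioc a 1, F y = f 0 y) (hx : x ∈ Ioc a 1) (hnear : x - a ≤ 4 * ν⁻¹)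
    (hI : IntervalIntegrable (fun y => (F x - F y) / (x - y) * φ 0 y) volume (-1) 1) :
    |∫ y in (-1:ℝ)..1, (F x - F y) / (x - y) * φ 0 y| ≤
      M * (x - a)⁻¹ * (CA K lam * (2 * C * (Real.pi + (d^2)⁻¹)) + CA K lam * (K * C)
        + (CA K lam + CB K + CG lam) * (C * (2 * (1 / (lam + 1) + 1))) * 4^(lam + 1)
        + CG lam * (2 * C * (Real.pi + (d^2)⁻¹)) + CG lam * 4^|lam| * (K * C)) * ν^(-lam - 1) := by
  have hν0 : 0 < ν := by linarith
  have ha' := abs_le.mp ha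
  have hi0 : 0 < ν⁻¹ := by positivity
  have hCA : 0 < CA K lam := by linarith [CA_ge (K := K) (lam := lam)]
  have hCB : 0 < CB K := CB_pos
  have hCG := CG_pos hμ1
  have hh : 0 < x - a := by linarith [hx.1]
  have hx1 := hx.2
  have hKl : lam ≤ K := by linarith
  set s := 4 * ν⁻¹ with hs
  set p := a - ν⁻¹ with hp
  set b := a + s with hb
  set g : ℝ → ℝ := fun y => (F x - F y) / (x - y) * φ 0 y with hg
  -- part A
  have bA : ∀ k ≤ K, ∀ y ≤ p, |As f x k y| ≤ CA K lam * M * (x-a)⁻¹ * |y - a|^(lam - k) := by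
    intro k hk y hy
    have e : |x - y| = x - y := abs_of_pos (by linarith)
    have e2 : |y - a| = a - y := by rw [abs_of_neg (by linarith)]; ring
    refine A_bound hf hM hμ1 hx hk (by rw [e2]; linarith) ?_ ?_ (Or.inr ?_)
    · rw [e]; linarith
    · rw [e, e2]; linarith
    · rw [e2]; linarith
  have dA := ibp_est (a := a) hφ hK hC hd ha hν (p := -1) (q := p) le_rfl (by linarith) (by linarith) hμ
    (M := CA K lam * M * (x-a)⁻¹) (by positivity) (u := As f x)
    (fun k hk y hy => A_deriv (by linarith [hy.2])) (A_cont (fun h => by linarith [h.2]))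
    (fun y hy => by
      rw [max_eq_left]
      · exact bA K le_rfl y hy.2
      · rw [abs_of_neg (by linarith [hy.2])]; linarith [hy.2])
  rw [Bd_neg_one hφ, sub_zero] at dA
  have dAp := Bd_est (μ := lam) (M := CA K lam * M * (x-a)⁻¹) (y := p) (u := As f x) hφ hC hν
    (by positivity) (by rw [abs_le]; constructor <;> linarith) (fun k hk => by
      refine (bA k hk.le p le_rfl).trans (le_of_eq ?_)
      have : |p - a| = ν⁻¹ := by rw [hp, sub_sub_cancel_left, abs_neg, abs_of_pos hi0]
      rw [this, Real.inv_rpow hν0.le, ← Real.rpow_neg hν0.le, neg_sub])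
  -- middle part
  have dM := crude (a := a) hφ hC ha hμ1 (M := (CA K lam + CB K + CG lam) * M * (x-a)⁻¹)
    (by positivity) (s := s) (by linarith) hνd
    (p := p) (q := b) (by linarith) (by linarith)
    le_rfl (u := fun y => (F x - F y) / (x - y)) (fun y hy hya =>
      g_near hK hμ1 hM hKL hf hF0 hF1 hx hnear (by linarith [hy.2]) hya)
  rw [hs, Real.mul_rpow (by norm_num) hi0.le, inv_rpow_succ hν0] at dM
  -- part G
  have dG := ibp_est (a := a) hφ hK hC hd ha hν (p := b) (q := 1) (by linarith) (by linarith) le_rfl hμ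
    (M := CG lam * M * (x-a)⁻¹) (by positivity) (u := gs f x)
    (fun k hk y hy => gs_deriv hf hx.1 (by omega) (by linarith [hy.1]))
    (fun y hy => (gs_deriv hf hx.1 (by omega) (by linarith [hy.1])).continuousAt.continuousWithinAt)
    (fun y hy => by
      rw [abs_of_pos (by linarith [hy.1] : 0 < y - a), max_eq_left (by linarith [hy.1])]
      exact gs_bound hf hM hμ1 hx (by omega) ⟨by linarith [hy.1], hy.2⟩ (by linarith [hy.1]))
  rw [Bd_one hφ, zero_sub, sub_neg_eq_add] at dG
  have dGb := Bd_est (μ := lam) (M := CG lam * M * (x-a)⁻¹ * 4^|lam|) (y := b) (u := gs f x) hφ hC hν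
    (by positivity) (by rw [abs_le]; constructor <;> linarith) (fun k hk => by
      refine (gs_bound hf hM hμ1 hx (by omega) (y := b) ⟨by linarith, by linarith⟩
        (by linarith)).trans ?_
      rw [hb, add_sub_cancel_left, hs, Real.mul_rpow (by norm_num) hi0.le, Real.inv_rpow hν0.le,
        ← Real.rpow_neg hν0.le, neg_sub, mul_assoc _ ((4:ℝ)^|lam|)]
      gcongr
      · norm_num
      · have : (0:ℝ) ≤ k := by positivity
        linarith [le_abs_self lam])
  -- splitting of the integral
  have ig1 : IntervalIntegrable g volume (-1) p := sub_int hI le_rfl (by linarith) (by linarith)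
  have ig2 : IntervalIntegrable g volume p b := sub_int hI (by linarith) (by linarith) (by linarith)
  have ig3 : IntervalIntegrable g volume b 1 := sub_int hI (by linarith) (by linarith) le_rfl
  have sA : ∫ y in (-1:ℝ)..p, g y = ∫ y in (-1:ℝ)..p, As f x 0 y * φ 0 y := by
    refine intervalIntegral.integral_congr_ae (Filter.Eventually.of_forall (fun y hy => ?_))
    rw [uIoc_of_le (by linarith)] at hy
    simp only [hg]
    rw [hF1 x hx, hF0 y (by linarith [hy.2]), As, invs]
    simp [div_eq_mul_inv]
  have sG : ∫ y in b..1, g y = ∫ y in b..1, gs f x 0 y * φ 0 y := by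
    refine intervalIntegral.integral_congr_ae ?_
    filter_upwards [ae_ne x] with y hyx hy
    rw [uIoc_of_le (by linarith)] at hy
    simp only [hg]
    rw [gs_zero hf (by omega) hx.1 (by linarith [hy.1]) hyx, hF1 x hx, hF1 y ⟨by linarith [hy.1], hy.2⟩]
  change |∫ y in (-1:ℝ)..1, g y| ≤ _
  rw [← intervalIntegral.integral_add_adjacent_intervals (ig1.trans ig2) ig3,
    ← intervalIntegral.integral_add_adjacent_intervals ig1 ig2, sA, sG]
  have tri : ∀ A B D E G : ℝ, |A + B + G| ≤ |A - D| + |D| + |B| + |G + E| + |E| := fun A B D E G => by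
    have := abs_add_le (A + B) G
    have := abs_add_le A B
    have h1 := abs_add_le (A - D) D
    rw [sub_add_cancel] at h1
    have h2 := abs_sub (G + E) E
    rw [add_sub_cancel_right] at h2
    linarith
  refine (tri _ _ (Bd (As f x) φ K p) (Bd (gs f x) φ K b) _).trans ?_
  calc _ ≤ _ := add_le_add (add_le_add (add_le_add (add_le_add dA dAp) dM) dG) dGb
    _ = _ := by ring

end
end JacAux


namespace JacAux

lemma sqrt_comb {n : ℝ} (hn : 0 < n) (p : ℝ) : Real.sqrt n * n^p = n^(p + 1/2) := by
  rw [Real.sqrt_eq_rpow, ← Real.rpow_add hn]; congr 1; ring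

lemma phi_lt {a lam : ℝ} {z : ℝ → ℝ} : ∀ y < a, phiFunI a lam z y = 0 := by
  intro y hy; simp [phiFunI, hy]

lemma phi_gt {a lam : ℝ} {z : ℝ → ℝ} {y : ℝ} (hy : a < y) :
    phiFunI a lam z y = z y * (y - a)^lam := by
  simp [phiFunI, not_lt.mpr hy.le, hy.ne']

lemma all_x {K L : ℕ} {d a lam M : ℝ} {f : ℕ → ℝ → ℝ} {F : ℝ → ℝ} {C : ℝ}
    (hK : 1 ≤ K) (hC : 0 < C) (hd : 0 < d) (ha : |a| ≤ 1 - 2 * d)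
    (hμ1 : -1 < lam) (hμ : lam + 2 ≤ K) (hM : 0 < M)
    (hKL : K + 2 ≤ L) (hf : FS L a lam M f) (hF0 : ∀ y < a, F y = 0)
    (hF1 : ∀ y ∈ Ioc a 1, F y = f 0 y) :
    ∃ D : ℝ, 0 < D ∧ ∀ ν : ℝ, 1 ≤ ν → 4 * ν⁻¹ ≤ d → ∀ φ, Ker K C d ν φ →
      ∀ x ∈ Ico (-1:ℝ) a ∪ Ioc a 1,
      |∫ y in (-1:ℝ)..1, (F x - F y) / (x - y) * φ 0 y| ≤ D * |x - a|⁻¹ * ν^(-lam - 1) := by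
  have hCA : 0 < CA K lam := by linarith [CA_ge (K := K) (lam := lam)]
  have hCB : 0 < CB K := CB_pos
  have hCG := CG_pos hμ1
  have hCs := Cst_pos (K := K) hμ1 hC hd
  have hl : 0 < lam + 1 := by linarith
  have hpi := Real.pi_pos
  set D1 := CB K * M * Cst K C d lam with hD1
  set D2 := (CA K lam * (2 * C * (Real.pi + (d^2)⁻¹)) + CB K * Cst K C d lam
        + CG lam * (2 * C * (Real.pi + (d^2)⁻¹))) with hD2
  set D3 := (CA K lam * (2 * C * (Real.pi + (d^2)⁻¹)) + CA K lam * (K * C)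
        + (CA K lam + CB K + CG lam) * (C * (2 * (1 / (lam + 1) + 1))) * 4^(lam + 1)
        + CG lam * (2 * C * (Real.pi + (d^2)⁻¹)) + CG lam * 4^|lam| * (K * C)) with hD3
  have p1 : 0 < D1 := by positivity
  have p2 : 0 < D2 := by positivity
  have p3 : 0 < D3 := by positivity
  refine ⟨D1 + M * D2 + M * D3, by positivity, ?_⟩
  intro ν hν hνd φ hφ x hx
  have hν0 : 0 < ν := by linarith
  have hi0 : 0 < ν⁻¹ := by positivity
  have q2 : 0 < M * D2 := by positivity
  have q3 : 0 < M * D3 := by positivity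
  rcases hx with hx | hx
  · refine (case_left hφ hK hC hd ha hν (by linarith) hμ1 hμ hM (by omega) hf hF0 hF1 hx.2).trans ?_
    gcongr
    linarith
  · by_cases hI : IntervalIntegrable (fun y => (F x - F y) / (x - y) * φ 0 y) volume (-1) 1
    swap
    · rw [intervalIntegral.integral_undef hI, abs_zero]; positivity
    have hh : 0 < x - a := by linarith [hx.1]
    rw [abs_of_pos hh]
    rcases le_total (4 * ν⁻¹) (x - a) with h | h
    · refine (case_far hφ hK hC hd ha hν hνd hμ1 hμ hM hKL hf hF0 hF1 hx h hI).trans ?_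
      rw [mul_right_comm M]
      gcongr
      linarith
    · refine (case_near hφ hK hC hd ha hν hνd hμ1 hμ hM hKL hf hF0 hF1 hx h hI).trans ?_
      rw [mul_right_comm M]
      gcongr
      linarith

end JacAux

theorem coeffG_decay_typeI (α β a lam : ℝ) (hα : -1 < α) (hβ : -1 < β)
    (ha : a ∈ Set.Ioo (-1 : ℝ) 1) (hlam : -1 < lam)
    (z : ℝ → ℝ) (hz : ContDiffOn ℝ (⊤ : ℕ∞) z (Set.Icc (-1 : ℝ) 1)) (hza : z a ≠ 0) :
    ∃ C : ℝ, 0 < C ∧ ∃ N : ℕ,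
      (∀ n : ℕ, N ≤ n → ∀ x ∈ Set.Ico (-1 : ℝ) a ∪ Set.Ioc a 1,
        |jacobiCoeffG α β n (phiFunI a lam z) x| ≤
          C * |x - a|⁻¹ * (n : ℝ) ^ (-lam - 1 / 2)) ∧
      (0 < lam → ∀ n : ℕ, N ≤ n →
        |jacobiCoeffG α β n (phiFunI a lam z) a| ≤ C * (n : ℝ) ^ (-lam + 1 / 2)) := by
  have habs : |a| < 1 := abs_lt.mpr ha
  obtain ⟨d, hdd⟩ : ∃ d : ℝ, d = (1 - |a|) / 2 := ⟨_, rfl⟩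
  have hd : 0 < d := by rw [hdd]; linarith
  have hd1 : d < 1 := by rw [hdd]; linarith [abs_nonneg a]
  have ha2 : |a| ≤ 1 - 2 * d := by rw [hdd]; linarith
  obtain ⟨K, hKd⟩ : ∃ K : ℕ, K = ⌈|lam|⌉₊ + 3 := ⟨_, rfl⟩
  have hK : 1 ≤ K := by omega
  have hμ : lam + 2 ≤ K := by
    have := Nat.le_ceil |lam|
    have := le_abs_self lam
    rw [hKd]; push_cast; linarith
  obtain ⟨Ck, hCk, N0, hker⟩ := JacAux.ker_exists α β hα hβ d hd hd1 K
  obtain ⟨M1, hM1, f1, hf1, hf1'⟩ := JacAux.FS_exists (K + 2) ha lam z hz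
  obtain ⟨M2, hM2, f2, hf2, hf2'⟩ := JacAux.FS_exists K ha (lam - 1) z hz
  obtain ⟨D, hD, hall⟩ := JacAux.all_x (F := phiFunI a lam z) hK hCk hd ha2 hlam hμ hM1 le_rfl hf1
    JacAux.phi_lt (fun y hy => by rw [JacAux.phi_gt hy.1, hf1' y hy])
  have hN : ∀ n : ℕ, N0 + ⌈4 / d⌉₊ + 1 ≤ n → N0 ≤ n ∧ (1:ℝ) ≤ n ∧ 4 * (n:ℝ)⁻¹ ≤ d := by
    intro n hn
    have h1 : 1 ≤ n := by omega
    have h1' : (1:ℝ) ≤ n := by exact_mod_cast h1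
    have h2 : 4 / d ≤ n := (Nat.le_ceil _).trans (by exact_mod_cast (by omega : ⌈4 / d⌉₊ ≤ n))
    refine ⟨by omega, h1', ?_⟩
    rw [div_le_iff₀ hd] at h2
    rw [← div_eq_mul_inv, div_le_iff₀ (by linarith)]
    linarith
  refine ⟨Ck * D + Ck * (M2 * |JacAux.Cst K Ck d (lam - 1)|), by positivity,
    N0 + ⌈4 / d⌉₊ + 1, ?_, ?_⟩
  · intro n hn x hx
    obtain ⟨n0, n1, n2⟩ := hN n hn
    obtain ⟨φ, hφ, hco⟩ := hker n n0
    have hn0 : (0:ℝ) < n := by linarith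
    have h := hall n n1 n2 φ hφ x hx
    have h2 := hco (fun y => (phiFunI a lam z x - phiFunI a lam z y) / (x - y))
    unfold jacobiCoeffG
    refine h2.trans ?_
    calc Ck * Real.sqrt n * |∫ y in (-1:ℝ)..1,
          (phiFunI a lam z x - phiFunI a lam z y) / (x - y) * φ 0 y|
        ≤ Ck * Real.sqrt n * (D * |x - a|⁻¹ * (n:ℝ)^(-lam - 1)) := by gcongr
      _ = Ck * D * |x - a|⁻¹ * (Real.sqrt n * (n:ℝ)^(-lam - 1)) := by ring
      _ = Ck * D * |x - a|⁻¹ * (n:ℝ)^(-lam - 1/2) := by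
          rw [JacAux.sqrt_comb hn0]; congr 2; ring
      _ ≤ _ := by
          gcongr
          have : 0 ≤ Ck * (M2 * |JacAux.Cst K Ck d (lam - 1)|) := by positivity
          linarith
  · intro hl n hn
    obtain ⟨n0, n1, n2⟩ := hN n hn
    obtain ⟨φ, hφ, hco⟩ := hker n n0
    have hn0 : (0:ℝ) < n := by linarith
    have hi0 : 0 < (n:ℝ)⁻¹ := by positivity
    have hCs : 0 < JacAux.Cst K Ck d (lam - 1) := JacAux.Cst_pos (by linarith) hCk hd
    rw [abs_of_pos hCs]
    have ea : phiFunI a lam z a = 0 := by simp [phiFunI, hl.ne']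
    have h : |∫ y in (-1:ℝ)..1, (phiFunI a lam z a - phiFunI a lam z y) / (a - y) * φ 0 y| ≤
        M2 * JacAux.Cst K Ck d (lam - 1) * (n:ℝ)^(-lam) := by
      by_cases hI : IntervalIntegrable
        (fun y => (phiFunI a lam z a - phiFunI a lam z y) / (a - y) * φ 0 y) volume (-1) 1
      swap
      · rw [intervalIntegral.integral_undef hI, abs_zero]; positivity
      obtain ⟨j1, j2⟩ := JacAux.int_right (a := a) (φ := φ)
        (g := fun y => (phiFunI a lam z a - phiFunI a lam z y) / (a - y)) (w := f2 0)
        ha.1.le ha.2.le hI (fun y hy => by simp only [ea, JacAux.phi_lt y hy]; simp)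
        (fun y hy => by
          have ht : 0 < y - a := by linarith [hy.1]
          simp only [ea, JacAux.phi_gt hy.1, hf2' y hy]
          rw [Real.rpow_sub_one ht.ne', zero_sub, ← neg_sub y a, neg_div_neg_eq, mul_div_assoc])
      rw [j2]
      have := JacAux.one_sided (a := a) hφ hK hCk hd ha2 n1 (by linarith) (μ := lam - 1)
        (by linarith) (by linarith) hM2.le (u := f2) (fun k hk y hy => hf2.der k hk y hy.1)
        ((hf2.cont K le_rfl).mono (fun y hy => hy.1)) (fun k hk y hy => hf2.bd k hk y hy) j1
      rwa [show -(lam - 1) - 1 = -lam by ring] at this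
    have h2 := hco (fun y => (phiFunI a lam z a - phiFunI a lam z y) / (a - y))
    unfold jacobiCoeffG
    refine h2.trans ?_
    calc Ck * Real.sqrt n * |∫ y in (-1:ℝ)..1,
          (phiFunI a lam z a - phiFunI a lam z y) / (a - y) * φ 0 y|
        ≤ Ck * Real.sqrt n * (M2 * JacAux.Cst K Ck d (lam - 1) * (n:ℝ)^(-lam)) := by gcongr
      _ = Ck * (M2 * JacAux.Cst K Ck d (lam - 1)) * (Real.sqrt n * (n:ℝ)^(-lam)) := by ring
      _ = Ck * (M2 * JacAux.Cst K Ck d (lam - 1)) * (n:ℝ)^(-lam + 1/2) := by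
          rw [JacAux.sqrt_comb hn0]
      _ ≤ _ := by
          gcongr
          have : 0 ≤ Ck * D := by positivity
          linarith
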